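/- arXiv:2209.12518 — 5 statements merged into one kernel-verified Lean document; each statement's English description precedes it below -/
import Mathlib

section
/- The images in H_{p,-1} of the 4p monomials a^i and b·a^i for 0 ≤ i ≤ 2p-1 form a ℂ-basis of H_{p,-1}; in particular dim_ℂ H_{p,-1} = 4p. -/
open scoped TensorProduct

noncomputable section

/-- The defining relations of the dual Radford algebra `H_{p,-1}`:
`a^(2p) = 1`, `b² = 0`, `b·a = ξ·(a·b)`, where `a` is `ι 0` and `b` is `ι 1`. -/
inductive HRel (p : ℕ) (ξ : ℂ) : FreeAlgebra ℂ (Fin 2) → FreeAlgebra ℂ (Fin 2) → Prop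
  | a_pow : HRel p ξ (FreeAlgebra.ι ℂ (0 : Fin 2) ^ (2 * p)) 1
  | b_sq : HRel p ξ (FreeAlgebra.ι ℂ (1 : Fin 2) * FreeAlgebra.ι ℂ (1 : Fin 2)) 0
  | b_a : HRel p ξ (FreeAlgebra.ι ℂ (1 : Fin 2) * FreeAlgebra.ι ℂ (0 : Fin 2))
      (ξ • (FreeAlgebra.ι ℂ (0 : Fin 2) * FreeAlgebra.ι ℂ (1 : Fin 2)))

/-- The dual Radford algebra `H_{p,-1}`, the quotient of the free algebra on `a`, `b`
by the two-sided ideal generated by `a^(2p) - 1`, `b²` and `b·a - ξ·a·b`. -/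
abbrev DualRadford (p : ℕ) (ξ : ℂ) : Type := RingQuot (HRel p ξ)

/-- The image of the generator `a` in `H_{p,-1}`. -/
def aH (p : ℕ) (ξ : ℂ) : DualRadford p ξ :=
  RingQuot.mkAlgHom ℂ (HRel p ξ) (FreeAlgebra.ι ℂ (0 : Fin 2))

/-- The image of the generator `b` in `H_{p,-1}`. -/
def bH (p : ℕ) (ξ : ℂ) : DualRadford p ξ :=
  RingQuot.mkAlgHom ℂ (HRel p ξ) (FreeAlgebra.ι ℂ (1 : Fin 2))

theorem aH_pow (p : ℕ) (ξ : ℂ) : aH p ξ ^ (2 * p) = 1 := by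
  simpa [aH] using RingQuot.mkAlgHom_rel ℂ (HRel.a_pow (p := p) (ξ := ξ))

theorem bH_mul_bH (p : ℕ) (ξ : ℂ) : bH p ξ * bH p ξ = 0 := by
  simpa [bH] using RingQuot.mkAlgHom_rel ℂ (HRel.b_sq (p := p) (ξ := ξ))

theorem bH_mul_aH (p : ℕ) (ξ : ℂ) : bH p ξ * aH p ξ = ξ • (aH p ξ * bH p ξ) := by
  simpa [aH, bH] using RingQuot.mkAlgHom_rel ℂ (HRel.b_a (p := p) (ξ := ξ))

/-- The lower triangular matrices `diag(t, ξ⁻¹ t)` and `E₁₀` satisfy the relations of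
`H_{p,-1}` whenever `t^(2p) = 1`, and so define a representation. -/
theorem exists_matrixRep {R : Type*} [CommRing R] [Algebra ℂ R] {p : ℕ} {ξ : ℂ}
    (hξ : ξ ^ (2 * p) = 1) (hξ0 : ξ ≠ 0) {t : R} (ht : t ^ (2 * p) = 1) :
    ∃ φ : DualRadford p ξ →ₐ[ℂ] Matrix (Fin 2) (Fin 2) R,
      φ (aH p ξ) = Matrix.diagonal ![t, ξ⁻¹ • t] ∧ φ (bH p ξ) = Matrix.single 1 0 1 := by
  let f : FreeAlgebra ℂ (Fin 2) →ₐ[ℂ] Matrix (Fin 2) (Fin 2) R :=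
    FreeAlgebra.lift ℂ ![Matrix.diagonal ![t, ξ⁻¹ • t], Matrix.single 1 0 1]
  have hf : ∀ ⦃x y⦄, HRel p ξ x y → f x = f y := by
    rintro _ _ (_ | _ | _)
    · simp only [f, map_pow, FreeAlgebra.lift_ι_apply, map_one, Matrix.cons_val_zero,
        Matrix.diagonal_pow]
      rw [← Matrix.diagonal_one]
      congr 1
      ext i
      fin_cases i <;> simp [ht, hξ, smul_pow]
    · simp [f]
    · ext i j
      fin_cases i <;> fin_cases j <;> simp [f, hξ0]
  refine ⟨RingQuot.liftAlgHom ℂ ⟨f, hf⟩, ?_, ?_⟩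
  · simp [aH, f]
  · simp [bH, f]

theorem linearIndependent_bH_pow_mul_aH_pow {p : ℕ} (hp : 1 ≤ p) {ξ : ℂ}
    (hξ : IsPrimitiveRoot ξ (2 * p)) :
    LinearIndependent ℂ (fun m : Fin 2 × Fin (2 * p) =>
      bH p ξ ^ (m.1 : ℕ) * aH p ξ ^ (m.2 : ℕ)) := by
  let q : Polynomial ℂ := Polynomial.X ^ (2 * p) - Polynomial.C 1
  have hq : q.Monic := Polynomial.monic_X_pow_sub_C 1 (by omega)
  have ht : AdjoinRoot.root q ^ (2 * p) = 1 := by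
    have h := AdjoinRoot.mk_self (f := q)
    simpa [q, sub_eq_zero] using h
  have hdeg : (AdjoinRoot.powerBasis' hq).dim = 2 * p := by
    simp only [AdjoinRoot.powerBasis'_dim]
    exact Polynomial.natDegree_X_pow_sub_C
  have hli : LinearIndependent ℂ (fun i : Fin (2 * p) => AdjoinRoot.root q ^ (i : ℕ)) := by
    simpa [Function.comp_def] using (AdjoinRoot.powerBasis' hq).basis.linearIndependent.comp _
      (finCongr hdeg.symm).injective
  obtain ⟨φ, ha, hb⟩ := exists_matrixRep hξ.pow_eq_one (hξ.ne_zero (by omega)) ht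
  have hcol (u v : Fin 2) (i : ℕ) : φ (bH p ξ ^ (u : ℕ) * aH p ξ ^ i) v 0 =
      if u = v then AdjoinRoot.root q ^ i else 0 := by
    rw [map_mul, map_pow, map_pow, ha, hb, Matrix.diagonal_pow, Matrix.mul_diagonal]
    fin_cases u <;> fin_cases v <;> simp
  rw [Fintype.linearIndependent_iff] at hli ⊢
  rintro c hc ⟨v, i⟩
  refine hli (fun i => c (v, i)) ?_ i
  have h := congrArg (fun x => φ x v 0) hc
  simp only [map_sum, map_smul, Matrix.sum_apply, Matrix.smul_apply, hcol, map_zero,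
    Matrix.zero_apply, Fintype.sum_prod_type_right] at h
  simpa using h

theorem aH_mul_bH_pow {p : ℕ} {ξ : ℂ} (hξ0 : ξ ≠ 0) (u : ℕ) :
    aH p ξ * bH p ξ ^ u = ξ⁻¹ ^ u • (bH p ξ ^ u * aH p ξ) := by
  have h : aH p ξ * bH p ξ = ξ⁻¹ • (bH p ξ * aH p ξ) := by
    rw [bH_mul_aH, inv_smul_smul₀ hξ0]
  induction u with
  | zero => simp
  | succ u ih =>
    rw [pow_succ, ← mul_assoc, ih, smul_mul_assoc, mul_assoc, h, mul_smul_comm, smul_smul,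
      ← pow_succ, ← mul_assoc]

theorem span_bH_pow_mul_aH_pow {p : ℕ} (hp : 1 ≤ p) {ξ : ℂ} (hξ0 : ξ ≠ 0) :
    Submodule.span ℂ (Set.range (fun m : Fin 2 × Fin (2 * p) =>
      bH p ξ ^ (m.1 : ℕ) * aH p ξ ^ (m.2 : ℕ))) = ⊤ := by
  set S := Submodule.span ℂ (Set.range (fun m : Fin 2 × Fin (2 * p) =>
      bH p ξ ^ (m.1 : ℕ) * aH p ξ ^ (m.2 : ℕ)))
  have hmem (u n : ℕ) : bH p ξ ^ u * aH p ξ ^ n ∈ S := by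
    rcases lt_or_ge u 2 with hu | hu
    · rw [pow_eq_pow_mod n (aH_pow p ξ)]
      exact Submodule.subset_span ⟨(⟨u, hu⟩, ⟨n % (2 * p), Nat.mod_lt _ (by omega)⟩), rfl⟩
    · rw [pow_eq_zero_of_le hu (by rw [pow_two, bH_mul_bH]), zero_mul]
      exact S.zero_mem
  have hgen (k : Fin 2) :
      S ≤ S.comap (LinearMap.mulLeft ℂ (RingQuot.mkAlgHom ℂ (HRel p ξ) (FreeAlgebra.ι ℂ k))) := by
    refine Submodule.span_le.mpr ?_
    rintro _ ⟨⟨u, i⟩, rfl⟩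
    match k with
    | 0 =>
      change aH p ξ * (bH p ξ ^ (u : ℕ) * aH p ξ ^ (i : ℕ)) ∈ S
      rw [← mul_assoc, aH_mul_bH_pow hξ0, smul_mul_assoc, mul_assoc, ← pow_succ']
      exact S.smul_mem _ (hmem _ _)
    | 1 =>
      change bH p ξ * (bH p ξ ^ (u : ℕ) * aH p ξ ^ (i : ℕ)) ∈ S
      rw [← mul_assoc, ← pow_succ']
      exact hmem _ _
  have hmul (x : FreeAlgebra ℂ (Fin 2)) : ∀ s ∈ S, RingQuot.mkAlgHom ℂ (HRel p ξ) x * s ∈ S := by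
    induction x using FreeAlgebra.induction with
    | grade0 r =>
      intro s hs
      rw [AlgHom.commutes, ← Algebra.smul_def]
      exact S.smul_mem r hs
    | grade1 k => exact fun s hs => hgen k hs
    | mul x y hx hy =>
      intro s hs
      rw [map_mul, mul_assoc]
      exact hx _ (hy s hs)
    | add x y hx hy =>
      intro s hs
      rw [map_add, add_mul]
      exact S.add_mem (hx s hs) (hy s hs)
  refine eq_top_iff.mpr fun x _ => ?_
  obtain ⟨y, rfl⟩ := RingQuot.mkAlgHom_surjective ℂ (HRel p ξ) x
  simpa using hmul y 1 (by simpa using hmem 0 0)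

/-- the `4p` monomials `b^u · a^i` (`u ∈ {0,1}`, `0 ≤ i ≤ 2p-1`) form a
`ℂ`-basis of `H_{p,-1}`; in particular `dim_ℂ H_{p,-1} = 4p`. -/
theorem statement0 (p : ℕ) (hp : 1 ≤ p) (ξ : ℂ) (hξ : IsPrimitiveRoot ξ (2 * p)) :
    LinearIndependent ℂ (fun m : Fin 2 × Fin (2 * p) =>
      bH p ξ ^ (m.1 : ℕ) * aH p ξ ^ (m.2 : ℕ)) ∧
    Submodule.span ℂ (Set.range (fun m : Fin 2 × Fin (2 * p) =>
      bH p ξ ^ (m.1 : ℕ) * aH p ξ ^ (m.2 : ℕ))) = ⊤ ∧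
    Module.finrank ℂ (DualRadford p ξ) = 4 * p := by
  have hli := linearIndependent_bH_pow_mul_aH_pow hp hξ
  have hspan := span_bH_pow_mul_aH_pow hp (hξ.ne_zero (by omega))
  refine ⟨hli, hspan, ?_⟩
  rw [Module.finrank_eq_card_basis (Module.Basis.mk hli hspan.ge)]
  simp only [Fintype.card_prod, Fintype.card_fin]
  ring
end
end

section
/- The set of nonzero elements h ∈ H satisfying Δ(h) = h ⊗ h is exactly {1, a^p}; i.e., the group of group-like elements of H_{p,-1} is {1, a^p}. -/
open scoped TensorProduct

noncomputable section

namespace DualRadford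

section Relations

variable (p : ℕ) (ξ : ℂ)

theorem aH_pow_two_mul : aH p ξ ^ (2 * p) = 1 := by
  have h := RingQuot.mkAlgHom_rel ℂ (HRel.a_pow (p := p) (ξ := ξ))
  rwa [map_pow, map_one] at h

theorem bH_mul_bH : bH p ξ * bH p ξ = 0 := by
  have h := RingQuot.mkAlgHom_rel ℂ (HRel.b_sq (p := p) (ξ := ξ))
  rwa [map_mul, map_zero] at h

theorem bH_mul_aH : bH p ξ * aH p ξ = ξ • (aH p ξ * bH p ξ) := by
  have h := RingQuot.mkAlgHom_rel ℂ (HRel.b_a (p := p) (ξ := ξ))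
  rwa [map_mul, map_smul, map_mul] at h

theorem bH_mul_aH_pow (n : ℕ) :
    bH p ξ * aH p ξ ^ n = ξ ^ n • (aH p ξ ^ n * bH p ξ) := by
  induction n with
  | zero => simp
  | succ n ih =>
    rw [pow_succ, ← mul_assoc, ih, smul_mul_assoc, mul_assoc, bH_mul_aH, mul_smul_comm,
      smul_smul, mul_assoc, ← pow_succ]

theorem bH_mul_aH_pow_mul_bH (n : ℕ) : bH p ξ * (aH p ξ ^ n * bH p ξ) = 0 := by
  rw [← mul_assoc, bH_mul_aH_pow, smul_mul_assoc, mul_assoc, bH_mul_bH, mul_zero, smul_zero]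

theorem aH_pow_val [NeZero (2 * p)] (n : ℕ) :
    aH p ξ ^ (n : ZMod (2 * p)).val = aH p ξ ^ n := by
  rw [ZMod.val_natCast]
  conv_rhs => rw [← Nat.mod_add_div n (2 * p), pow_add, pow_mul, aH_pow_two_mul, one_pow, mul_one]

/-- The elements `a ^ n` and `a ^ n * b` span `H_{p,-1}`. -/
theorem span_monomials :
    Submodule.span ℂ (Set.range (fun n : ℕ => aH p ξ ^ n) ∪
      Set.range (fun n : ℕ => aH p ξ ^ n * bH p ξ)) = ⊤ := by
  set S := Submodule.span ℂ (Set.range (fun n : ℕ => aH p ξ ^ n) ∪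
      Set.range (fun n : ℕ => aH p ξ ^ n * bH p ξ)) with hS
  have h₀ (n : ℕ) : aH p ξ ^ n ∈ S := Submodule.subset_span (Or.inl ⟨n, rfl⟩)
  have h₁ (n : ℕ) : aH p ξ ^ n * bH p ξ ∈ S := Submodule.subset_span (Or.inr ⟨n, rfl⟩)
  have ha (s : DualRadford p ξ) (hs : s ∈ S) : aH p ξ * s ∈ S := by
    induction hs using Submodule.span_induction with
    | mem x hx =>
      rcases hx with ⟨n, rfl⟩ | ⟨n, rfl⟩
      · simpa only [← pow_succ'] using h₀ (n + 1)
      · simpa only [← mul_assoc, ← pow_succ'] using h₁ (n + 1)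
    | zero => simp
    | add x y _ _ hx hy => rw [mul_add]; exact S.add_mem hx hy
    | smul c x _ hx => rw [mul_smul_comm]; exact S.smul_mem c hx
  have hb (s : DualRadford p ξ) (hs : s ∈ S) : bH p ξ * s ∈ S := by
    induction hs using Submodule.span_induction with
    | mem x hx =>
      rcases hx with ⟨n, rfl⟩ | ⟨n, rfl⟩
      · simpa only [bH_mul_aH_pow] using S.smul_mem _ (h₁ n)
      · simp only [bH_mul_aH_pow_mul_bH, S.zero_mem]
    | zero => simp
    | add x y _ _ hx hy => rw [mul_add]; exact S.add_mem hx hy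
    | smul c x _ hx => rw [mul_smul_comm]; exact S.smul_mem c hx
  have key (x : FreeAlgebra ℂ (Fin 2)) :
      ∀ s ∈ S, RingQuot.mkAlgHom ℂ (HRel p ξ) x * s ∈ S := by
    induction x using FreeAlgebra.induction with
    | grade0 r =>
      intro s hs
      rw [AlgHom.commutes, ← Algebra.smul_def]
      exact S.smul_mem r hs
    | grade1 i => fin_cases i <;> [exact ha; exact hb]
    | mul x y hx hy =>
      intro s hs
      rw [map_mul, mul_assoc]
      exact hx _ (hy _ hs)
    | add x y hx hy =>
      intro s hs
      rw [map_add, add_mul]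
      exact S.add_mem (hx _ hs) (hy _ hs)
  refine Submodule.eq_top_iff'.2 fun h => ?_
  obtain ⟨x, rfl⟩ := RingQuot.mkAlgHom_surjective ℂ (HRel p ξ) h
  simpa using key x 1 (by simpa using h₀ 0)

variable {p ξ} in
theorem linearMap_ext {M : Type*} [AddCommMonoid M] [Module ℂ M]
    {f g : DualRadford p ξ →ₗ[ℂ] M} (h₀ : ∀ n : ℕ, f (aH p ξ ^ n) = g (aH p ξ ^ n))
    (h₁ : ∀ n : ℕ, f (aH p ξ ^ n * bH p ξ) = g (aH p ξ ^ n * bH p ξ)) : f = g := by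
  refine LinearMap.ext_on (span_monomials p ξ) ?_
  rintro _ (⟨n, rfl⟩ | ⟨n, rfl⟩)
  exacts [h₀ n, h₁ n]

end Relations

section Coordinates

variable (p : ℕ) (ξ : ℂ)

/-- The group algebra of the cyclic group generated by `a`. -/
abbrev CyclicAlgebra : Type := AddMonoidAlgebra ℂ (ZMod (2 * p))

/-- The generator of the cyclic group, as an element of its group algebra. -/
def gen : CyclicAlgebra p := AddMonoidAlgebra.single 1 1

theorem gen_pow (n : ℕ) : gen p ^ n = AddMonoidAlgebra.single (n : ZMod (2 * p)) 1 := by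
  simp [gen, AddMonoidAlgebra.single_pow]

/-- The matrix by which `a` acts. -/
def matA : Matrix (Fin 2) (Fin 2) (CyclicAlgebra p) := !![gen p, 0; 0, ξ • gen p]

/-- The matrix by which `b` acts. -/
def matB : Matrix (Fin 2) (Fin 2) (CyclicAlgebra p) := !![0, 1; 0, 0]

theorem matA_pow (n : ℕ) : matA p ξ ^ n = !![gen p ^ n, 0; 0, ξ ^ n • gen p ^ n] := by
  induction n with
  | zero => simp [Matrix.one_fin_two]
  | succ n ih =>
    rw [pow_succ, ih]
    simp [matA, pow_succ, smul_smul]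

variable {p ξ}

/-- A faithful representation of `H_{p,-1}` by matrices over the group algebra. -/
def rep (hξ : ξ ^ (2 * p) = 1) :
    DualRadford p ξ →ₐ[ℂ] Matrix (Fin 2) (Fin 2) (CyclicAlgebra p) :=
  RingQuot.liftAlgHom ℂ ⟨FreeAlgebra.lift ℂ ![matA p ξ, matB p], by
    intro x y h
    cases h with
    | a_pow =>
      have hg : gen p ^ (2 * p) = 1 := by
        rw [gen_pow, ZMod.natCast_self, AddMonoidAlgebra.one_def]
      simp [matA_pow, hg, hξ, Matrix.one_fin_two]
    | b_sq =>
      ext i j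
      fin_cases i <;> fin_cases j <;> simp [matB]
    | b_a =>
      ext i j
      fin_cases i <;> fin_cases j <;> simp [matA, matB]⟩

theorem rep_aH (hξ : ξ ^ (2 * p) = 1) : rep hξ (aH p ξ) = matA p ξ := by
  simp [rep, aH]

theorem rep_bH (hξ : ξ ^ (2 * p) = 1) : rep hξ (bH p ξ) = matB p := by
  simp [rep, bH]

/-- The coefficient of `a ^ i`. -/
def coeffA (hξ : ξ ^ (2 * p) = 1) (i : ZMod (2 * p)) : DualRadford p ξ →ₗ[ℂ] ℂ where
  toFun h := (rep hξ h 0 0).coeff i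
  map_add' x y := by simp
  map_smul' c x := by simp

/-- The coefficient of `a ^ i * b`. -/
def coeffB (hξ : ξ ^ (2 * p) = 1) (i : ZMod (2 * p)) : DualRadford p ξ →ₗ[ℂ] ℂ where
  toFun h := (rep hξ h 0 1).coeff i
  map_add' x y := by simp
  map_smul' c x := by simp

@[simp]
theorem coeffA_pow (hξ : ξ ^ (2 * p) = 1) (i : ZMod (2 * p)) (n : ℕ) :
    coeffA hξ i (aH p ξ ^ n) = if (n : ZMod (2 * p)) = i then 1 else 0 := by
  simp [coeffA, rep_aH, matA_pow, gen_pow, Finsupp.single_apply]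

@[simp]
theorem coeffA_pow_mul (hξ : ξ ^ (2 * p) = 1) (i : ZMod (2 * p)) (n : ℕ) :
    coeffA hξ i (aH p ξ ^ n * bH p ξ) = 0 := by
  simp [coeffA, rep_aH, rep_bH, matA_pow, matB]

@[simp]
theorem coeffB_pow (hξ : ξ ^ (2 * p) = 1) (i : ZMod (2 * p)) (n : ℕ) :
    coeffB hξ i (aH p ξ ^ n) = 0 := by
  simp [coeffB, rep_aH, matA_pow]

@[simp]
theorem coeffB_pow_mul (hξ : ξ ^ (2 * p) = 1) (i : ZMod (2 * p)) (n : ℕ) :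
    coeffB hξ i (aH p ξ ^ n * bH p ξ) = if (n : ZMod (2 * p)) = i then 1 else 0 := by
  simp [coeffB, rep_aH, rep_bH, matA_pow, matB, gen_pow, Finsupp.single_apply]

theorem sum_coeff [NeZero (2 * p)] (hξ : ξ ^ (2 * p) = 1) (h : DualRadford p ξ) :
    h = ∑ i : ZMod (2 * p), (coeffA hξ i h • aH p ξ ^ i.val +
      coeffB hξ i h • (aH p ξ ^ i.val * bH p ξ)) := by
  have key : LinearMap.id = ∑ i : ZMod (2 * p), ((coeffA hξ i).smulRight (aH p ξ ^ i.val) +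
      (coeffB hξ i).smulRight (aH p ξ ^ i.val * bH p ξ)) := by
    apply linearMap_ext <;> intro n <;> simp [aH_pow_val, -ZMod.val_natCast]
  simpa using LinearMap.congr_fun key h

end Coordinates

theorem add_smul_pow_succ {A : Type*} [Semiring A] [Algebra ℂ A] {x y : A} {q : ℂ} (c : ℂ)
    (hyx : y * x = q • (x * y)) (hyy : y * y = 0) (n : ℕ) :
    (x + c • y) ^ (n + 1) =
      x ^ (n + 1) + (c * ∑ i ∈ Finset.range (n + 1), q ^ i) • (x ^ n * y) := by
  induction n with
  | zero => simp
  | succ n ih =>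
    have h₁ : x ^ n * y * x = q • (x ^ (n + 1) * y) := by
      rw [mul_assoc, hyx, mul_smul_comm, ← mul_assoc, ← pow_succ]
    have h₂ : x ^ n * y * y = 0 := by rw [mul_assoc, hyy, mul_zero]
    rw [pow_succ, ih, geom_sum_succ (n := n + 1)]
    simp only [add_mul, mul_add, smul_mul_assoc, mul_smul_comm, h₁, h₂, ← pow_succ]
    module

theorem coefficient_eq_zero_iff {p : ℕ} (hp : 1 ≤ p) {ξ : ℂ} (hξ : IsPrimitiveRoot ξ (2 * p))
    (n : ℕ) :
    ((ξ - 1) / (ξ + 1))⁻¹ * ∑ i ∈ Finset.range n, (ξ ^ 2) ^ i = 0 ↔ p ∣ n := by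
  rcases hp.eq_or_lt with rfl | hp
  · have : ξ = -1 := IsPrimitiveRoot.eq_neg_one_of_two_right (by simpa using hξ)
    simp [this]
  · have hq : ξ ^ 2 ≠ 1 := fun h => by
      have := Nat.le_of_dvd two_pos (hξ.dvd_of_pow_eq_one 2 h)
      omega
    have h₁ : ξ - 1 ≠ 0 := fun h => hq (by linear_combination (ξ + 1) * h)
    have h₂ : ξ + 1 ≠ 0 := fun h => hq (by linear_combination (ξ - 1) * h)
    have hg := geom_sum_mul (ξ ^ 2) n
    have hd : p ∣ n ↔ (ξ ^ 2) ^ n = 1 := by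
      rw [← pow_mul, hξ.pow_eq_one_iff_dvd, Nat.mul_dvd_mul_iff_left two_pos]
    rw [mul_eq_zero, or_iff_right (inv_ne_zero (div_ne_zero h₁ h₂)), hd, ← sub_eq_zero (b := (1:ℂ)),
      ← hg, mul_eq_zero, or_iff_left (sub_ne_zero.2 hq)]

section Comultiplication

variable {p : ℕ} {ξ : ℂ}
  {Δ : DualRadford p ξ →ₐ[ℂ] DualRadford p ξ ⊗[ℂ] DualRadford p ξ}

theorem comul_pow_succ
    (hΔa : Δ (aH p ξ) = aH p ξ ⊗ₜ[ℂ] aH p ξ +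
      ((ξ - 1) / (ξ + 1))⁻¹ • (bH p ξ ⊗ₜ[ℂ] (bH p ξ * aH p ξ ^ p))) (n : ℕ) :
    Δ (aH p ξ ^ (n + 1)) = (aH p ξ ^ (n + 1)) ⊗ₜ[ℂ] (aH p ξ ^ (n + 1)) +
      (((ξ - 1) / (ξ + 1))⁻¹ * (∑ i ∈ Finset.range (n + 1), (ξ ^ 2) ^ i) * ξ ^ p) •
        ((aH p ξ ^ n * bH p ξ) ⊗ₜ[ℂ] (aH p ξ ^ (n + p) * bH p ξ)) := by
  rw [map_pow, hΔa]
  refine (add_smul_pow_succ (q := ξ ^ 2) _ ?_ ?_ n).trans ?_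
  · have h : bH p ξ * aH p ξ ^ p * aH p ξ = ξ • (aH p ξ * (bH p ξ * aH p ξ ^ p)) := by
      rw [mul_assoc, ← pow_succ, pow_succ', ← mul_assoc, bH_mul_aH, smul_mul_assoc, mul_assoc]
    rw [Algebra.TensorProduct.tmul_mul_tmul, Algebra.TensorProduct.tmul_mul_tmul, h, bH_mul_aH,
      TensorProduct.tmul_smul, ← TensorProduct.smul_tmul', smul_smul, ← pow_two]
  · simp [Algebra.TensorProduct.tmul_mul_tmul, bH_mul_bH]
  · simp only [Algebra.TensorProduct.tmul_pow, Algebra.TensorProduct.tmul_mul_tmul,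
      bH_mul_aH_pow, mul_smul_comm, TensorProduct.tmul_smul, smul_smul, ← mul_assoc, ← pow_add]

theorem comul_pow_mul
    (hΔa : Δ (aH p ξ) = aH p ξ ⊗ₜ[ℂ] aH p ξ +
      ((ξ - 1) / (ξ + 1))⁻¹ • (bH p ξ ⊗ₜ[ℂ] (bH p ξ * aH p ξ ^ p)))
    (hΔb : Δ (bH p ξ) = bH p ξ ⊗ₜ[ℂ] (aH p ξ ^ (p + 1)) + aH p ξ ⊗ₜ[ℂ] bH p ξ) (n : ℕ) :
    Δ (aH p ξ ^ n * bH p ξ) = (aH p ξ ^ n * bH p ξ) ⊗ₜ[ℂ] (aH p ξ ^ (n + p + 1)) +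
      (aH p ξ ^ (n + 1)) ⊗ₜ[ℂ] (aH p ξ ^ n * bH p ξ) := by
  rw [map_mul, hΔb]
  cases n with
  | zero => simp
  | succ n =>
    rw [comul_pow_succ hΔa]
    simp only [add_mul, mul_add, smul_mul_assoc, Algebra.TensorProduct.tmul_mul_tmul,
      mul_assoc, bH_mul_bH, mul_zero, TensorProduct.zero_tmul, TensorProduct.tmul_zero, smul_zero,
      add_zero, ← pow_add, ← pow_succ, add_assoc]

/-- The linear map `h ↦ (f ⊗ g) (Δ h)`. -/
def convolve (Δ : DualRadford p ξ →ₐ[ℂ] DualRadford p ξ ⊗[ℂ] DualRadford p ξ)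
    (f g : DualRadford p ξ →ₗ[ℂ] ℂ) : DualRadford p ξ →ₗ[ℂ] ℂ :=
  LinearMap.mul' ℂ ℂ ∘ₗ TensorProduct.map f g ∘ₗ Δ.toLinearMap

theorem convolve_apply_of_groupLike {h : DualRadford p ξ} (hh : Δ h = h ⊗ₜ[ℂ] h)
    (f g : DualRadford p ξ →ₗ[ℂ] ℂ) : convolve Δ f g h = f h * g h := by
  simp [convolve, hh]

theorem convolve_coeffA_coeffA (hξ : ξ ^ (2 * p) = 1)
    (hΔa : Δ (aH p ξ) = aH p ξ ⊗ₜ[ℂ] aH p ξ +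
      ((ξ - 1) / (ξ + 1))⁻¹ • (bH p ξ ⊗ₜ[ℂ] (bH p ξ * aH p ξ ^ p)))
    (hΔb : Δ (bH p ξ) = bH p ξ ⊗ₜ[ℂ] (aH p ξ ^ (p + 1)) + aH p ξ ⊗ₜ[ℂ] bH p ξ)
    (i j : ZMod (2 * p)) :
    convolve Δ (coeffA hξ i) (coeffA hξ j) = if i = j then coeffA hξ i else 0 := by
  apply linearMap_ext
  · rintro (_ | n)
    · have := coeffA_pow hξ i 0
      have := coeffA_pow hξ j 0
      simp only [pow_zero, Nat.cast_zero] at *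
      simp only [convolve, LinearMap.comp_apply, AlgHom.toLinearMap_apply, map_one,
        Algebra.TensorProduct.one_def, TensorProduct.map_tmul, LinearMap.mul'_apply, *]
      split_ifs <;> simp_all
    · have := coeffA_pow hξ i (n + 1)
      simp only [convolve, LinearMap.comp_apply, AlgHom.toLinearMap_apply, comul_pow_succ hΔa,
        map_add, map_smul, TensorProduct.map_tmul, LinearMap.mul'_apply, coeffA_pow,
        coeffA_pow_mul]
      split_ifs <;> simp_all
  · intro n
    simp only [convolve, LinearMap.comp_apply, AlgHom.toLinearMap_apply, comul_pow_mul hΔa hΔb,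
      map_add, TensorProduct.map_tmul, LinearMap.mul'_apply, coeffA_pow_mul]
    split_ifs <;> simp

theorem convolve_coeffB_coeffA (hξ : ξ ^ (2 * p) = 1)
    (hΔa : Δ (aH p ξ) = aH p ξ ⊗ₜ[ℂ] aH p ξ +
      ((ξ - 1) / (ξ + 1))⁻¹ • (bH p ξ ⊗ₜ[ℂ] (bH p ξ * aH p ξ ^ p)))
    (hΔb : Δ (bH p ξ) = bH p ξ ⊗ₜ[ℂ] (aH p ξ ^ (p + 1)) + aH p ξ ⊗ₜ[ℂ] bH p ξ)
    (i j : ZMod (2 * p)) :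
    convolve Δ (coeffB hξ i) (coeffA hξ j) = if i + p + 1 = j then coeffB hξ i else 0 := by
  apply linearMap_ext
  · rintro (_ | n)
    · have := coeffB_pow hξ i 0
      simp only [pow_zero] at *
      simp only [convolve, LinearMap.comp_apply, AlgHom.toLinearMap_apply, map_one,
        Algebra.TensorProduct.one_def, TensorProduct.map_tmul, LinearMap.mul'_apply, *]
      split_ifs <;> simp_all
    · simp only [convolve, LinearMap.comp_apply, AlgHom.toLinearMap_apply, comul_pow_succ hΔa,
        map_add, map_smul, TensorProduct.map_tmul, LinearMap.mul'_apply, coeffB_pow,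
        coeffA_pow_mul]
      split_ifs <;> simp
  · intro n
    simp only [convolve, LinearMap.comp_apply, AlgHom.toLinearMap_apply, comul_pow_mul hΔa hΔb,
      map_add, TensorProduct.map_tmul, LinearMap.mul'_apply, coeffA_pow_mul, coeffB_pow_mul,
      coeffA_pow, coeffB_pow]
    by_cases hn : (n : ZMod (2 * p)) = i
    · subst hn
      split_ifs <;> simp_all
    · split_ifs <;> simp_all

theorem convolve_coeffA_coeffB (hξ : ξ ^ (2 * p) = 1)
    (hΔa : Δ (aH p ξ) = aH p ξ ⊗ₜ[ℂ] aH p ξ +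
      ((ξ - 1) / (ξ + 1))⁻¹ • (bH p ξ ⊗ₜ[ℂ] (bH p ξ * aH p ξ ^ p)))
    (hΔb : Δ (bH p ξ) = bH p ξ ⊗ₜ[ℂ] (aH p ξ ^ (p + 1)) + aH p ξ ⊗ₜ[ℂ] bH p ξ)
    (i j : ZMod (2 * p)) :
    convolve Δ (coeffA hξ i) (coeffB hξ j) = if j + 1 = i then coeffB hξ j else 0 := by
  apply linearMap_ext
  · rintro (_ | n)
    · have := coeffB_pow hξ j 0
      simp only [pow_zero] at *
      simp only [convolve, LinearMap.comp_apply, AlgHom.toLinearMap_apply, map_one,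
        Algebra.TensorProduct.one_def, TensorProduct.map_tmul, LinearMap.mul'_apply, *]
      split_ifs <;> simp_all
    · simp only [convolve, LinearMap.comp_apply, AlgHom.toLinearMap_apply, comul_pow_succ hΔa,
        map_add, map_smul, TensorProduct.map_tmul, LinearMap.mul'_apply, coeffB_pow,
        coeffA_pow_mul]
      split_ifs <;> simp
  · intro n
    simp only [convolve, LinearMap.comp_apply, AlgHom.toLinearMap_apply, comul_pow_mul hΔa hΔb,
      map_add, TensorProduct.map_tmul, LinearMap.mul'_apply, coeffA_pow_mul, coeffB_pow_mul,
      coeffA_pow, coeffB_pow]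
    by_cases hn : (n : ZMod (2 * p)) = j
    · subst hn
      split_ifs <;> simp_all
    · split_ifs <;> simp_all

theorem exists_eq_aH_pow_of_groupLike [NeZero (2 * p)] (hξ : ξ ^ (2 * p) = 1)
    (hΔa : Δ (aH p ξ) = aH p ξ ⊗ₜ[ℂ] aH p ξ +
      ((ξ - 1) / (ξ + 1))⁻¹ • (bH p ξ ⊗ₜ[ℂ] (bH p ξ * aH p ξ ^ p)))
    (hΔb : Δ (bH p ξ) = bH p ξ ⊗ₜ[ℂ] (aH p ξ ^ (p + 1)) + aH p ξ ⊗ₜ[ℂ] bH p ξ)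
    {h : DualRadford p ξ} (h0 : h ≠ 0) (hh : Δ h = h ⊗ₜ[ℂ] h) :
    ∃ n < 2 * p, h = aH p ξ ^ n := by
  have hAA (i j : ZMod (2 * p)) : coeffA hξ i h * coeffA hξ j h =
      if i = j then coeffA hξ i h else 0 := by
    rw [← convolve_apply_of_groupLike hh, convolve_coeffA_coeffA hξ hΔa hΔb]
    split_ifs <;> rfl
  have hBA (i j : ZMod (2 * p)) : coeffB hξ i h * coeffA hξ j h =
      if i + p + 1 = j then coeffB hξ i h else 0 := by
    rw [← convolve_apply_of_groupLike hh, convolve_coeffB_coeffA hξ hΔa hΔb]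
    split_ifs <;> rfl
  have hAB (i j : ZMod (2 * p)) : coeffA hξ i h * coeffB hξ j h =
      if j + 1 = i then coeffB hξ j h else 0 := by
    rw [← convolve_apply_of_groupLike hh, convolve_coeffA_coeffB hξ hΔa hΔb]
    split_ifs <;> rfl
  have hp0 : (p : ZMod (2 * p)) ≠ 0 := by
    have := NeZero.ne (2 * p)
    rw [Ne, ZMod.natCast_eq_zero_iff]
    intro hd
    have := Nat.le_of_dvd (by omega) hd
    omega
  have hB (i : ZMod (2 * p)) : coeffB hξ i h = 0 := by
    by_contra hi
    have h₁ := hBA i (i + p + 1)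
    have h₂ := hAB (i + p + 1) i
    rw [if_pos rfl] at h₁
    rw [if_neg (by simpa [add_assoc, add_left_comm] using hp0), mul_comm, h₁] at h₂
    exact hi h₂
  obtain ⟨k, hk⟩ : ∃ k, coeffA hξ k h ≠ 0 := by
    by_contra! hA
    exact h0 (by rw [sum_coeff hξ h]; simp [hA, hB])
  refine ⟨k.val, ZMod.val_lt k, ?_⟩
  have hk1 : coeffA hξ k h = 1 := by
    have := hAA k k
    rw [if_pos rfl] at this
    exact mul_left_cancel₀ hk (by rw [this, mul_one])
  have hA (i : ZMod (2 * p)) : coeffA hξ i h = if i = k then 1 else 0 := by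
    split_ifs with hi
    · rw [hi, hk1]
    · simpa [hk1, hi] using hAA i k
  rw [sum_coeff hξ h]
  simp [hA, hB]

end Comultiplication

end DualRadford

open DualRadford

/-- the group-like elements of `H_{p,-1}` (nonzero `h` with `Δ h = h ⊗ h`)
are exactly `1` and `a^p`. -/
theorem statement2 (p : ℕ) (hp : 1 ≤ p) (ξ : ℂ) (hξ : IsPrimitiveRoot ξ (2 * p))
    (Δ : DualRadford p ξ →ₐ[ℂ] DualRadford p ξ ⊗[ℂ] DualRadford p ξ)
    (hΔa : Δ (aH p ξ) = aH p ξ ⊗ₜ[ℂ] aH p ξ +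
      ((ξ - 1) / (ξ + 1))⁻¹ • (bH p ξ ⊗ₜ[ℂ] (bH p ξ * aH p ξ ^ p)))
    (hΔb : Δ (bH p ξ) = bH p ξ ⊗ₜ[ℂ] (aH p ξ ^ (p + 1)) + aH p ξ ⊗ₜ[ℂ] bH p ξ) :
    {h : DualRadford p ξ | h ≠ 0 ∧ Δ h = h ⊗ₜ[ℂ] h} =
      {1, aH p ξ ^ p} := by
  have : NeZero (2 * p) := ⟨by omega⟩
  have hξ1 := hξ.pow_eq_one
  have hξ0 : ξ ≠ 0 := hξ.ne_zero (by omega)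
  have hne (n : ℕ) : aH p ξ ^ n ≠ 0 := fun h => by
    simpa [h] using coeffA_pow hξ1 n n
  ext h
  simp only [Set.mem_ofPred_eq, Set.mem_insert_iff, Set.mem_singleton_iff]
  constructor
  · rintro ⟨h0, hh⟩
    obtain ⟨n, hn, rfl⟩ := exists_eq_aH_pow_of_groupLike hξ1 hΔa hΔb h0 hh
    rcases n with _ | n
    · exact Or.inl (pow_zero _)
    · right
      rw [comul_pow_succ hΔa] at hh
      have key := congrArg (LinearMap.mul' ℂ ℂ ∘ₗ
        TensorProduct.map (coeffB hξ1 n) (coeffB hξ1 (n + p : ℕ))) hh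
      simp only [LinearMap.comp_apply, map_add, map_smul, TensorProduct.map_tmul, LinearMap.mul'_apply,
        coeffB_pow_mul, coeffB_pow, if_true, mul_zero, zero_add, smul_eq_mul, mul_one] at key
      have hd := (coefficient_eq_zero_iff hp hξ (n + 1)).1
        ((mul_eq_zero.1 key).resolve_right (pow_ne_zero _ hξ0))
      obtain ⟨m, hm⟩ := hd
      have hm1 : m = 1 := by
        have : m < 2 := by
          by_contra! hm2
          nlinarith
        interval_cases m <;> omega
      rw [hm, hm1, mul_one]
  · rintro (rfl | rfl)
    · exact ⟨by simpa using hne 0, by rw [map_one, Algebra.TensorProduct.one_def]⟩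
    · refine ⟨hne p, ?_⟩
      obtain ⟨n, rfl⟩ : ∃ n, p = n + 1 := ⟨p - 1, by omega⟩
      rw [comul_pow_succ hΔa, (coefficient_eq_zero_iff hp hξ _).2 dvd_rfl, zero_mul, zero_smul,
        add_zero]
end
end

section
/- For (i,j), (r,s) ∈ Λ_p, the D-modules V_{i,j} and V_{r,s} are isomorphic if and only if (i,j) = (r,s). -/
open scoped TensorProduct

noncomputable section

/-- Generator `a` of the free algebra on four generators. -/
def fa : FreeAlgebra ℂ (Fin 4) := FreeAlgebra.ι ℂ (0 : Fin 4)

/-- Generator `b` of the free algebra on four generators. -/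
def fb : FreeAlgebra ℂ (Fin 4) := FreeAlgebra.ι ℂ (1 : Fin 4)

/-- Generator `g` of the free algebra on four generators. -/
def fg : FreeAlgebra ℂ (Fin 4) := FreeAlgebra.ι ℂ (2 : Fin 4)

/-- Generator `x` of the free algebra on four generators. -/
def fx : FreeAlgebra ℂ (Fin 4) := FreeAlgebra.ι ℂ (3 : Fin 4)

/-- The defining relations of the Drinfeld double `D = D(H_{p,-1}^cop)`. -/
inductive DRel (p : ℕ) (ξ θ : ℂ) : FreeAlgebra ℂ (Fin 4) → FreeAlgebra ℂ (Fin 4) → Prop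
  | a_pow : DRel p ξ θ (fa ^ (2 * p)) 1
  | b_sq : DRel p ξ θ (fb * fb) 0
  | b_a : DRel p ξ θ (fb * fa) (ξ • (fa * fb))
  | g_pow : DRel p ξ θ (fg ^ (2 * p)) 1
  | x_sq : DRel p ξ θ (fx * fx) (1 - fg * fg)
  | g_x : DRel p ξ θ (fg * fx) (-(fx * fg))
  | a_g : DRel p ξ θ (fa * fg) (fg * fa)
  | b_g : DRel p ξ θ (fb * fg) (-(fg * fb))
  | a_x : DRel p ξ θ (fa * fx - ξ • (fx * fa))
      ((((ξ - 1) / (ξ + 1))⁻¹ * θ * ξ ^ (p + 1)) • (fb * fa ^ p - fg * fb))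
  | b_x : DRel p ξ θ (fb * fx - ξ • (fx * fb))
      ((θ * ξ ^ (p + 1)) • (fa ^ (p + 1) - fg * fa))

/-- The Drinfeld double `D = D(H_{p,-1}^cop)`, presented by generators and relations. -/
abbrev DAlg (p : ℕ) (ξ θ : ℂ) : Type := RingQuot (DRel p ξ θ)

/-- The image of the generator `a` in `D`. -/
def aD (p : ℕ) (ξ θ : ℂ) : DAlg p ξ θ := RingQuot.mkAlgHom ℂ (DRel p ξ θ) fa

/-- The image of the generator `b` in `D`. -/
def bD (p : ℕ) (ξ θ : ℂ) : DAlg p ξ θ := RingQuot.mkAlgHom ℂ (DRel p ξ θ) fb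

/-- The image of the generator `g` in `D`. -/
def gD (p : ℕ) (ξ θ : ℂ) : DAlg p ξ θ := RingQuot.mkAlgHom ℂ (DRel p ξ θ) fg

/-- The image of the generator `x` in `D`. -/
def xD (p : ℕ) (ξ θ : ℂ) : DAlg p ξ θ := RingQuot.mkAlgHom ℂ (DRel p ξ θ) fx

/-- The matrix of the action of `a` on `V_{i,j}`. -/
def Ma (ξ : ℂ) (i : ℕ) : Matrix (Fin 2) (Fin 2) ℂ := !![ξ ^ i, 0; 0, ξ ^ (i + 1)]

/-- The matrix of the action of `b` on `V_{i,j}`. -/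
def Mb : Matrix (Fin 2) (Fin 2) ℂ := !![0, 1; 0, 0]

/-- The matrix of the action of `g` on `V_{i,j}`. -/
def Mg (ξ : ℂ) (j : ℕ) : Matrix (Fin 2) (Fin 2) ℂ := !![ξ ^ j, 0; 0, -ξ ^ j]

/-- The matrix of the action of `x` on `V_{i,j}`. -/
def Mx (p : ℕ) (ξ θ : ℂ) (i j : ℕ) : Matrix (Fin 2) (Fin 2) ℂ :=
  !![0, θ⁻¹ * ξ ^ ((p : ℤ) - 1 - (i : ℤ)) * ((-1 : ℂ) ^ i + ξ ^ j);
     θ * ξ ^ (p + 1 + i) * ((-1 : ℂ) ^ i - ξ ^ j), 0]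

/-- Two algebra homomorphisms out of `D` which agree on the four generators are equal. -/
theorem DAlg.algHom_ext {p : ℕ} {ξ θ : ℂ} {A : Type*} [Semiring A] [Algebra ℂ A]
    {σ τ : DAlg p ξ θ →ₐ[ℂ] A} (ha : σ (aD p ξ θ) = τ (aD p ξ θ))
    (hb : σ (bD p ξ θ) = τ (bD p ξ θ)) (hg : σ (gD p ξ θ) = τ (gD p ξ θ))
    (hx : σ (xD p ξ θ) = τ (xD p ξ θ)) : σ = τ := by
  apply RingQuot.ringQuot_ext'
  apply FreeAlgebra.hom_ext
  funext k
  fin_cases k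
  exacts [ha, hb, hg, hx]

/-- for `(i,j), (r,s) ∈ Λ_p`, the `D`-modules `V_{i,j}` and `V_{r,s}` are
isomorphic if and only if `(i,j) = (r,s)`. -/
theorem statement9 (p : ℕ) (hp : 1 ≤ p) (ξ θ : ℂ) (hξ : IsPrimitiveRoot ξ (2 * p))
    (hθ : θ ^ 2 = (1 - (ξ ^ 2)⁻¹) * ((ξ - 1) / (ξ + 1)))
    (i j r s : ℕ) (hi : i < 2 * p) (hj : j < 2 * p) (hr : r < 2 * p) (hs : s < 2 * p)
    (hΛij : ¬ ((2 * p : ℤ) ∣ ((p : ℤ) * (i : ℤ) - (j : ℤ))))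
    (hΛrs : ¬ ((2 * p : ℤ) ∣ ((p : ℤ) * (r : ℤ) - (s : ℤ))))
    (σ σ' : DAlg p ξ θ →ₐ[ℂ] Matrix (Fin 2) (Fin 2) ℂ)
    (hσa : σ (aD p ξ θ) = Ma ξ i) (hσb : σ (bD p ξ θ) = Mb)
    (hσg : σ (gD p ξ θ) = Mg ξ j) (hσx : σ (xD p ξ θ) = Mx p ξ θ i j)
    (hσ'a : σ' (aD p ξ θ) = Ma ξ r) (hσ'b : σ' (bD p ξ θ) = Mb)
    (hσ'g : σ' (gD p ξ θ) = Mg ξ s) (hσ'x : σ' (xD p ξ θ) = Mx p ξ θ r s) :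
    (∃ e : (Fin 2 → ℂ) ≃ₗ[ℂ] (Fin 2 → ℂ),
        ∀ (d : DAlg p ξ θ) (v : Fin 2 → ℂ), e ((σ d).mulVec v) = (σ' d).mulVec (e v)) ↔
      (i = r ∧ j = s) := by
  constructor
  · rintro ⟨e, he⟩
    set w := e ![1, 0] with hw
    have hb : Mb.mulVec w = 0 := by
      rw [hw, ← hσ'b, ← he, hσb]
      refine (e.map_eq_zero_iff).mpr ?_
      ext k
      fin_cases k <;> simp [Mb, Matrix.mulVec, dotProduct]
    have hw1 : w 1 = 0 := by simpa [Mb, Matrix.mulVec, dotProduct] using congrFun hb 0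
    have hw0 : w 0 ≠ 0 := by
      intro h0
      have hz : w = 0 := by
        ext k
        fin_cases k
        exacts [h0, hw1]
      have hv := (e.map_eq_zero_iff).mp hz
      simpa using congrFun hv 0
    have ha : ξ ^ i • w = (Ma ξ r).mulVec w := by
      rw [hw, ← map_smul, ← hσ'a, ← he, hσa]
      congr 1
      ext k
      fin_cases k <;> simp [Ma, Matrix.mulVec, dotProduct]
    have hg : ξ ^ j • w = (Mg ξ s).mulVec w := by
      rw [hw, ← map_smul, ← hσ'g, ← he, hσg]
      congr 1
      ext k
      fin_cases k <;> simp [Mg, Matrix.mulVec, dotProduct]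
    have ha0 := congrFun ha 0
    have hg0 := congrFun hg 0
    simp only [Ma, Mg, Matrix.mulVec, dotProduct, Fin.sum_univ_two, Pi.smul_apply, smul_eq_mul,
      Matrix.of_apply, Matrix.cons_val_zero, Matrix.cons_val_one, zero_mul, add_zero]
      at ha0 hg0
    exact ⟨hξ.pow_inj hi hr (mul_right_cancel₀ hw0 ha0),
      hξ.pow_inj hj hs (mul_right_cancel₀ hw0 hg0)⟩
  · rintro ⟨rfl, rfl⟩
    have h : σ = σ' := DAlg.algHom_ext (hσa.trans hσ'a.symm) (hσb.trans hσ'b.symm)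
      (hσg.trans hσ'g.symm) (hσx.trans hσ'x.symm)
    subst h
    exact ⟨LinearEquiv.refl ℂ _, fun _ _ => rfl⟩
end
end

section
/- The images of the 32p monomials y^r·x^s·a^t·b^u with r, u ∈ {0,1}, s ∈ {0,1,2,3}, t ∈ {0,…,2p-1} form a ℂ-basis of 𝔄_{i,j}(μ); in particular dim_ℂ 𝔄_{i,j}(μ) = 32p. -/
open scoped TensorProduct

noncomputable section

/-- Generator `x` of the free algebra on four generators. -/
def Xg : FreeAlgebra ℂ (Fin 4) := FreeAlgebra.ι ℂ (0 : Fin 4)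

/-- Generator `y` of the free algebra on four generators. -/
def Yg : FreeAlgebra ℂ (Fin 4) := FreeAlgebra.ι ℂ (1 : Fin 4)

/-- Generator `a` of the free algebra on four generators. -/
def Ag : FreeAlgebra ℂ (Fin 4) := FreeAlgebra.ι ℂ (2 : Fin 4)

/-- Generator `b` of the free algebra on four generators. -/
def Bg : FreeAlgebra ℂ (Fin 4) := FreeAlgebra.ι ℂ (3 : Fin 4)

/-- The defining relations of the Hopf algebra `𝔄_{i,j}(μ)` for `(i,j) ∈ Λ³_p`. -/
inductive A3Rel (p i j : ℕ) (ξ θ μ : ℂ) :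
    FreeAlgebra ℂ (Fin 4) → FreeAlgebra ℂ (Fin 4) → Prop
  | r1 : A3Rel p i j ξ θ μ (Ag ^ (2 * p)) 1
  | r2 : A3Rel p i j ξ θ μ (Bg * Bg) 0
  | r3 : A3Rel p i j ξ θ μ (Bg * Ag) (ξ • (Ag * Bg))
  | r4 : A3Rel p i j ξ θ μ (Ag * Xg) (ξ ^ i • (Xg * Ag))
  | r5 : A3Rel p i j ξ θ μ (Bg * Xg) (ξ ^ i • (Xg * Bg))
  | r6 : A3Rel p i j ξ θ μ (Ag * Yg + Yg * Ag) (((ξ - 1) / (ξ + 1))⁻¹ • (Xg * Bg * Ag ^ p))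
  | r7 : A3Rel p i j ξ θ μ (Bg * Yg + Yg * Bg) (Xg * Ag ^ (p + 1))
  | r8 : A3Rel p i j ξ θ μ (Xg ^ 4) 0
  | r9 : A3Rel p i j ξ θ μ (Xg * Yg + Yg * Xg) (μ • (Bg * Ag ^ (2 * p - 1)))
  | r10 : A3Rel p i j ξ θ μ (Yg * Yg + (θ ^ 2)⁻¹ • (Xg * Xg)) ((μ / 2) • (1 - Ag ^ p))

/-- The Hopf algebra `𝔄_{i,j}(μ)` for `(i,j) ∈ Λ³_p`. -/
abbrev A3 (p i j : ℕ) (ξ θ μ : ℂ) : Type := RingQuot (A3Rel p i j ξ θ μ)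

/-- The image of the generator `x` in `𝔄_{i,j}(μ)`. -/
def xA3 (p i j : ℕ) (ξ θ μ : ℂ) : A3 p i j ξ θ μ := RingQuot.mkAlgHom ℂ (A3Rel p i j ξ θ μ) Xg

/-- The image of the generator `y` in `𝔄_{i,j}(μ)`. -/
def yA3 (p i j : ℕ) (ξ θ μ : ℂ) : A3 p i j ξ θ μ := RingQuot.mkAlgHom ℂ (A3Rel p i j ξ θ μ) Yg

/-- The image of the generator `a` in `𝔄_{i,j}(μ)`. -/
def aA3 (p i j : ℕ) (ξ θ μ : ℂ) : A3 p i j ξ θ μ := RingQuot.mkAlgHom ℂ (A3Rel p i j ξ θ μ) Ag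

/-- The image of the generator `b` in `𝔄_{i,j}(μ)`. -/
def bA3 (p i j : ℕ) (ξ θ μ : ℂ) : A3 p i j ξ θ μ := RingQuot.mkAlgHom ℂ (A3Rel p i j ξ θ μ) Bg

/-- The relations between the generators `x`, `a`, `b`, which involve neither `y` nor `μ`. -/
structure SkewRel {R : Type*} [Ring R] [Algebra ℂ R] (p : ℕ) (ξ q : ℂ) (x a b : R) : Prop where
  a_pow : a ^ (2 * p) = 1
  b_mul_b : b * b = 0
  b_mul_a : b * a = ξ • (a * b)
  a_mul_x : a * x = q • (x * a)
  b_mul_x : b * x = q • (x * b)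
  x_pow : x ^ 4 = 0

namespace SkewRel

section Relations

variable {R : Type*} [Ring R] [Algebra ℂ R] {p : ℕ} {ξ q : ℂ} {x a b : R}

lemma a_pow_mul_x (h : SkewRel p ξ q x a b) (n : ℕ) : a ^ n * x = q ^ n • (x * a ^ n) := by
  induction n with
  | zero => simp
  | succ n ih =>
    rw [pow_succ', mul_assoc, ih, mul_smul_comm, ← mul_assoc, h.a_mul_x, smul_mul_assoc, smul_smul,
      mul_assoc, pow_succ]

lemma a_mul_x_pow (h : SkewRel p ξ q x a b) (n : ℕ) : a * x ^ n = q ^ n • (x ^ n * a) := by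
  induction n with
  | zero => simp
  | succ n ih =>
    rw [pow_succ, ← mul_assoc, ih, smul_mul_assoc, mul_assoc, h.a_mul_x, mul_smul_comm, smul_smul,
      mul_assoc, pow_succ]

lemma b_mul_x_pow (h : SkewRel p ξ q x a b) (n : ℕ) : b * x ^ n = q ^ n • (x ^ n * b) := by
  induction n with
  | zero => simp
  | succ n ih =>
    rw [pow_succ, ← mul_assoc, ih, smul_mul_assoc, mul_assoc, h.b_mul_x, mul_smul_comm, smul_smul,
      mul_assoc, pow_succ]

lemma b_mul_a_pow (h : SkewRel p ξ q x a b) (n : ℕ) : b * a ^ n = ξ ^ n • (a ^ n * b) := by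
  induction n with
  | zero => simp
  | succ n ih =>
    rw [pow_succ, ← mul_assoc, ih, smul_mul_assoc, mul_assoc, h.b_mul_a, mul_smul_comm, smul_smul,
      mul_assoc, pow_succ]

lemma b_mul_x_mul_b (h : SkewRel p ξ q x a b) : b * x * b = 0 := by
  rw [h.b_mul_x, smul_mul_assoc, mul_assoc, h.b_mul_b, mul_zero, smul_zero]

lemma a_mul_a_pow_sub (h : SkewRel p ξ q x a b) (hp : 1 ≤ p) : a * a ^ (2 * p - 1) = 1 := by
  rw [← pow_succ', Nat.sub_add_cancel (by omega), h.a_pow]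

lemma a_pow_sub_mul_a (h : SkewRel p ξ q x a b) (hp : 1 ≤ p) : a ^ (2 * p - 1) * a = 1 := by
  rw [← pow_succ, Nat.sub_add_cancel (by omega), h.a_pow]

lemma a_pow_mul_a_pow (h : SkewRel p ξ q x a b) : a ^ p * a ^ p = 1 := by
  rw [← pow_add, ← two_mul, h.a_pow]

lemma a_mul_b (h : SkewRel p ξ q x a b) (hq : q * ξ = -1) : a * b = (-q) • (b * a) := by
  rw [h.b_mul_a, smul_smul, neg_mul, hq, neg_neg, one_smul]

lemma x_mul_b_mul_a_pow (h : SkewRel p ξ q x a b) (hp : 1 ≤ p) :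
    x * b * a ^ p * a ^ (2 * p - 1) * a = x * b * a ^ p := by
  rw [mul_assoc, h.a_pow_sub_mul_a hp, mul_one]

lemma a_mul_x_mul_b_mul_a_pow (h : SkewRel p ξ q x a b) (hp : 1 ≤ p) (hq : q * ξ = -1) :
    a * (x * b * a ^ p * a ^ (2 * p - 1)) = (-q ^ 2) • (x * b * a ^ p) := by
  conv_rhs => rw [← h.x_mul_b_mul_a_pow hp]
  simp only [← mul_assoc]
  rw [h.a_mul_x]
  simp only [smul_mul_assoc]
  rw [mul_assoc x a b, h.a_mul_b hq]
  simp only [smul_mul_assoc, mul_smul_comm, smul_smul]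
  rw [show q * -q = -q ^ 2 by ring]
  have hc : a * (a ^ p * a ^ (2 * p - 1)) = a ^ p * a ^ (2 * p - 1) * a := by
    rw [← pow_add, pow_mul_comm']
  rw [show x * (b * a) * a ^ p * a ^ (2 * p - 1) = x * b * (a * (a ^ p * a ^ (2 * p - 1))) by
    simp only [mul_assoc], hc]
  simp only [mul_assoc]

end Relations

end SkewRel

section Extension

variable {R : Type*} [Ring R] [Algebra ℂ R]

/-- Left multiplication by `x` on `R ⊕ y R`. -/
def extX (p : ℕ) (μ : ℂ) (x a b : R) : Matrix (Fin 2) (Fin 2) R :=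
  !![x, μ • (b * a ^ (2 * p - 1)); 0, -x]

/-- Left multiplication by `y` on `R ⊕ y R`. -/
def extY (p : ℕ) (θ μ : ℂ) (x a : R) : Matrix (Fin 2) (Fin 2) R :=
  !![0, (μ / 2) • (1 - a ^ p) - (θ ^ 2)⁻¹ • (x * x); 1, 0]

/-- Left multiplication by `a` on `R ⊕ y R`. -/
def extA (p : ℕ) (ξ : ℂ) (x a b : R) : Matrix (Fin 2) (Fin 2) R :=
  !![a, ((ξ - 1) / (ξ + 1))⁻¹ • (x * b * a ^ p); 0, -a]

/-- Left multiplication by `b` on `R ⊕ y R`. -/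
def extB (p : ℕ) (x a b : R) : Matrix (Fin 2) (Fin 2) R :=
  !![b, x * a ^ (p + 1); 0, -b]

variable {p : ℕ} {ξ q θ μ : ℂ} {x a b : R}

namespace SkewRel

lemma exists_extA_pow (h : SkewRel p ξ q x a b) (hp : 1 ≤ p) (hq : q * ξ = -1) (n : ℕ) :
    ∃ κ : ℂ, (q ^ 2 - 1) * κ = -((-1) ^ n * ((ξ - 1) / (ξ + 1))⁻¹ * (q ^ (2 * n) - 1)) ∧
    extA p ξ x a b ^ n =
      !![a ^ n, κ • (x * b * a ^ p * a ^ (2 * p - 1) * a ^ n); 0, (-1) ^ n * a ^ n] := by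
  induction n with
  | zero => exact ⟨0, by simp, by simp [Matrix.one_fin_two]⟩
  | succ n ih =>
    obtain ⟨κ, hκ, e⟩ := ih
    refine ⟨-q ^ 2 * κ + (-1) ^ n * ((ξ - 1) / (ξ + 1))⁻¹, ?_, ?_⟩
    · linear_combination (-q ^ 2) * hκ
    · have hw : a * (x * b * a ^ p * a ^ (2 * p - 1) * a ^ n) =
          (-q ^ 2) • (x * b * a ^ p * a ^ n) := by
        rw [← mul_assoc, h.a_mul_x_mul_b_mul_a_pow hp hq, smul_mul_assoc]
      have hw' : x * b * a ^ p * a ^ (2 * p - 1) * (a * a ^ n) = x * b * a ^ p * a ^ n := by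
        rw [← mul_assoc, h.x_mul_b_mul_a_pow hp]
      have hs : x * b * a ^ p * ((-1) ^ n * a ^ n) = ((-1) ^ n : ℂ) • (x * b * a ^ p * a ^ n) := by
        rcases neg_one_pow_eq_or ℂ n with e | e <;> rcases Nat.even_or_odd n with o | o <;>
          simp [o.neg_one_pow]
      rw [pow_succ', e, extA, Matrix.mul_fin_two]
      simp only [pow_succ' a, hw', mul_smul_comm, smul_mul_assoc, hw, hs, smul_smul, zero_mul,
        mul_zero, add_zero]
      congr 1
      ext i j
      fin_cases i <;> fin_cases j <;> simp
      · module
      · rw [pow_succ, ← mul_assoc a, ((Commute.neg_one_right a).pow_right n).eq]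
        simp [mul_assoc]

lemma extA_pow (h : SkewRel p ξ q x a b) (hp : 1 ≤ p) (hpe : Even p) (hq : q * ξ = -1)
    (hq1 : q ^ 2 ≠ 1) (hqp : q ^ p = -1) :
    extA p ξ x a b ^ p = !![a ^ p, 0; 0, a ^ p] := by
  obtain ⟨κ, hκ, e⟩ := h.exists_extA_pow hp hq p
  have : κ = 0 := by
    rw [mul_comm 2 p, pow_mul, hqp] at hκ
    have : (q ^ 2 - 1) * κ = 0 := by rw [hκ]; ring
    exact (mul_eq_zero.mp this).resolve_left (sub_ne_zero.mpr hq1)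
  rw [e, this, hpe.neg_one_pow, zero_smul, one_mul]

lemma extB_mul_extA_pow (h : SkewRel p ξ q x a b) (hp : 1 ≤ p) (hq : q * ξ = -1) :
    extB p x a b * extA p ξ x a b ^ (2 * p - 1) =
      !![b * a ^ (2 * p - 1), -(x * a ^ p); 0, b * a ^ (2 * p - 1)] := by
  obtain ⟨κ, -, e⟩ := h.exists_extA_pow hp hq (2 * p - 1)
  have ho : Odd (2 * p - 1) := ⟨p - 1, by omega⟩
  rw [e, extB, Matrix.mul_fin_two, ho.neg_one_pow]
  have h1 : b * (x * b * a ^ p * a ^ (2 * p - 1) * a ^ (2 * p - 1)) = 0 := by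
    simp only [← mul_assoc, h.b_mul_x_mul_b, zero_mul]
  have h2 : x * a ^ (p + 1) * a ^ (2 * p - 1) = x * a ^ p := by
    rw [pow_succ, mul_assoc, mul_assoc, h.a_mul_a_pow_sub hp, mul_one]
  simp [h1, h2]

/-- The operators `x`, `y`, `a`, `b` on `R ⊕ y R` satisfy the relations of `A3`. -/
lemma ext_rel (h : SkewRel p ξ q x a b) (hp : 1 ≤ p) (hpe : Even p) (hq : q * ξ = -1)
    (hξ1 : ξ ≠ 1) (hξ2 : ξ ≠ -1) (hξp : ξ ^ p = -1)
    (hθ : θ ^ 2 = (1 - (ξ ^ 2)⁻¹) * ((ξ - 1) / (ξ + 1))) {i j : ℕ} (hi : ξ ^ i = q) :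
    ∀ ⦃u v⦄, A3Rel p i j ξ θ μ u v →
      FreeAlgebra.lift ℂ ![extX p μ x a b, extY p θ μ x a, extA p ξ x a b, extB p x a b] u =
      FreeAlgebra.lift ℂ ![extX p μ x a b, extY p θ μ x a, extA p ξ x a b, extB p x a b] v := by
  have hξ0 : ξ ≠ 0 := by rintro rfl; simp at hq
  have hqe : q = -ξ⁻¹ := by field_simp; linear_combination hq
  have hq0 : q ≠ 0 := by rintro rfl; simp at hq
  have hqp : q ^ p = -1 := by rw [hqe, hpe.neg_pow, inv_pow, hξp]; norm_num
  have hq1 : q ^ 2 ≠ 1 := by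
    rw [hqe, neg_sq, inv_pow, ne_eq, inv_eq_one, sq, mul_self_eq_one_iff]
    exact fun e => e.elim hξ1 hξ2
  have hc : (θ ^ 2)⁻¹ * (1 - q ^ 2) = ((ξ - 1) / (ξ + 1))⁻¹ := by
    have hs : 1 - (ξ ^ 2)⁻¹ ≠ 0 := by
      rw [← inv_pow, ← neg_sq, ← hqe]
      exact sub_ne_zero.mpr hq1.symm
    rw [hθ, hqe, neg_sq, inv_pow, mul_inv, mul_right_comm, inv_mul_cancel₀ hs, one_mul]
  have hc' : (θ ^ 2)⁻¹ * (1 - q ^ 2) = (ξ + 1) / (ξ - 1) := by rw [hc, inv_div]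
  have hA := h.extA_pow hp hpe hq hq1 hqp
  have hB := h.extB_mul_extA_pow hp hq
  have hPx : a ^ p * x = -(x * a ^ p) := by rw [h.a_pow_mul_x, hqp, neg_one_smul]
  have hbP : b * a ^ p = -(a ^ p * b) := by rw [h.b_mul_a_pow, hξp, neg_one_smul]
  have hPa : a ^ p * a = a * a ^ p := (pow_mul_comm' a p)
  have hPP := h.a_pow_mul_a_pow
  have hξ' : ξ ^ (2 * p - 1) = -q := by
    refine mul_right_cancel₀ hξ0 ?_
    rw [neg_mul, hq, ← pow_succ, Nat.sub_add_cancel (by omega), mul_comm 2 p, pow_mul, hξp]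
    norm_num
  have hq' : q ^ (2 * p - 1) = -ξ := by
    refine mul_right_cancel₀ hq0 ?_
    rw [neg_mul, mul_comm ξ, hq, ← pow_succ, Nat.sub_add_cancel (by omega), mul_comm 2 p, pow_mul,
      hqp]
    norm_num
  have hax := h.a_mul_x
  have hbx := h.b_mul_x
  have hba := h.b_mul_a
  have hbb := h.b_mul_b
  have hAx : a ^ (2 * p - 1) * x = (-ξ) • (x * a ^ (2 * p - 1)) := by rw [h.a_pow_mul_x, hq']
  have hbA : b * a ^ (2 * p - 1) = (-q) • (a ^ (2 * p - 1) * b) := by rw [h.b_mul_a_pow, hξ']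
  have hP1 : a ^ (p + 1) = a * a ^ p := pow_succ' a p
  have hx4 := h.x_pow
  have reassoc {u v w : R} (e : u * v = w) (z : R) : u * (v * z) = w * z := by
    rw [← mul_assoc, e]
  have haxr := reassoc hax
  have hbxr := reassoc hbx
  have hbar := reassoc hba
  have hAxr := reassoc hAx
  have hbAr := reassoc hbA
  have haAr := reassoc (h.a_mul_a_pow_sub hp)
  have hAar := reassoc (h.a_pow_sub_mul_a hp)
  have hPxr := reassoc hPx
  have hbPr := reassoc hbP
  have hPPr := reassoc hPP
  intro u v r
  cases r <;> simp only [Ag, Bg, Xg, Yg, map_pow, map_mul, map_add, map_sub, map_smul, map_one,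
    map_zero, FreeAlgebra.lift_ι_apply, Matrix.cons_val]
  case r1 => simp [mul_comm 2 p, pow_mul, hA, sq, hPP, Matrix.one_fin_two]
  case r8 =>
    have e (M : Matrix (Fin 2) (Fin 2) R) : M ^ 4 = (M * M) * (M * M) := by noncomm_ring
    have hx : x * (x * (x * x)) = 0 := by simpa [pow_succ, mul_assoc] using hx4
    have hX : extX p μ x a b * extX p μ x a b = !![x * x, 0; 0, x * x] := by
      simp [extX, mul_assoc, hAx, hbxr, smul_smul, hq, mul_comm ξ q]
    rw [e, hX]
    ext k l
    fin_cases k <;> fin_cases l <;> simp [mul_assoc, hx]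
  all_goals
    try rw [pow_succ']
    try rw [hB]
    try rw [hA]
    simp only [extA, extB, extX, extY, hP1, hi]
    generalize a ^ (2 * p - 1) = A at *
    generalize a ^ p = P at *
    ext k l
    fin_cases k <;> fin_cases l <;>
      simp [mul_sub, sub_mul, mul_assoc, smul_smul, hax, hbx, hba, hbb, hbA, hPx, hbP, hPa, hPP,
        haxr, hbxr, hbar, hAxr, hbAr, haAr, hAar, hPxr, hbPr, hPPr]
  · match_scalars
    linear_combination -hq
  · match_scalars
    linear_combination -hq
  · match_scalars
    · linear_combination -(μ * q) * hq
    · ring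
  · match_scalars
    linear_combination hc'
  · match_scalars
    · ring
    · linear_combination μ * hq
    · linear_combination hc'
  · module
  · match_scalars <;> ring
  · match_scalars
    linear_combination -(θ⁻¹ * θ⁻¹ * μ * q) * hq
  · match_scalars <;> ring

end SkewRel

end Extension

section Spanning

variable {R : Type*} [Ring R] [Algebra ℂ R] {p : ℕ} {ξ q : ℂ} {x y a b : R}

/-- The span of the monomials `x ^ s * a ^ t * b ^ u`. -/
def skewSpan (x a b : R) : Submodule ℂ R :=
  Submodule.span ℂ (Set.range fun m : ℕ × ℕ × ℕ => x ^ m.1 * a ^ m.2.1 * b ^ m.2.2)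

lemma monomial_mem_skewSpan (x a b : R) (s t u : ℕ) :
    x ^ s * a ^ t * b ^ u ∈ skewSpan x a b :=
  Submodule.subset_span ⟨(s, t, u), rfl⟩

lemma mul_mem_skewSpan_of_monomial {z : R}
    (hz : ∀ s t u : ℕ, z * (x ^ s * a ^ t * b ^ u) ∈ skewSpan x a b) {c : R}
    (hc : c ∈ skewSpan x a b) : z * c ∈ skewSpan x a b := by
  have : skewSpan x a b ≤ (skewSpan x a b).comap (LinearMap.mulLeft ℂ z) := by
    refine Submodule.span_le.mpr ?_
    rintro _ ⟨⟨s, t, u⟩, rfl⟩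
    exact hz s t u
  exact this hc

lemma x_mul_mem_skewSpan {c : R} (hc : c ∈ skewSpan x a b) : x * c ∈ skewSpan x a b :=
  mul_mem_skewSpan_of_monomial (fun s t u => by
    simpa only [pow_succ', mul_assoc] using monomial_mem_skewSpan x a b (s + 1) t u) hc

namespace SkewRel

lemma a_mul_mem_skewSpan (h : SkewRel p ξ q x a b) {c : R} (hc : c ∈ skewSpan x a b) :
    a * c ∈ skewSpan x a b :=
  mul_mem_skewSpan_of_monomial (fun s t u => by
    rw [← mul_assoc, ← mul_assoc, h.a_mul_x_pow, smul_mul_assoc, smul_mul_assoc, mul_assoc (x ^ s),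
      ← pow_succ']
    exact Submodule.smul_mem _ _ (monomial_mem_skewSpan x a b s (t + 1) u)) hc

lemma b_mul_mem_skewSpan (h : SkewRel p ξ q x a b) {c : R} (hc : c ∈ skewSpan x a b) :
    b * c ∈ skewSpan x a b :=
  mul_mem_skewSpan_of_monomial (fun s t u => by
    rw [← mul_assoc, ← mul_assoc, h.b_mul_x_pow, smul_mul_assoc, smul_mul_assoc, mul_assoc (x ^ s),
      h.b_mul_a_pow, mul_smul_comm, smul_mul_assoc, ← mul_assoc, mul_assoc _ b, ← pow_succ']
    exact Submodule.smul_mem _ _ (Submodule.smul_mem _ _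
      (monomial_mem_skewSpan x a b s t (u + 1)))) hc

lemma a_pow_mul_mem_skewSpan (h : SkewRel p ξ q x a b) (n : ℕ) {c : R}
    (hc : c ∈ skewSpan x a b) : a ^ n * c ∈ skewSpan x a b := by
  induction n with
  | zero => simpa using hc
  | succ n ih => rw [pow_succ', mul_assoc]; exact h.a_mul_mem_skewSpan ih

/-- The elements `c + y * c'` with `c`, `c'` in the span of the monomials in `x`, `a`, `b` are stable
under left multiplication by the generators. -/
lemma mem_skewSpan_sup (h : SkewRel p ξ q x a b) {θ' μ ν c₀ : ℂ}
    (hay : a * y + y * a = c₀ • (x * b * a ^ p)) (hby : b * y + y * b = x * a ^ (p + 1))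
    (hxy : x * y + y * x = μ • (b * a ^ (2 * p - 1)))
    (hyy : y * y + θ' • (x * x) = ν • (1 - a ^ p)) {z c : R} (hz : z ∈ ({x, y, a, b} : Set R))
    (hc : c ∈ skewSpan x a b ⊔ (skewSpan x a b).map (LinearMap.mulLeft ℂ y)) :
    z * c ∈ skewSpan x a b ⊔ (skewSpan x a b).map (LinearMap.mulLeft ℂ y) := by
  obtain ⟨d, hd, _, ⟨e, he, rfl⟩, rfl⟩ := Submodule.mem_sup.mp hc
  have key {v w : R} (hv : v ∈ skewSpan x a b) (hw : w ∈ skewSpan x a b) :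
      v + y * w ∈ skewSpan x a b ⊔ (skewSpan x a b).map (LinearMap.mulLeft ℂ y) :=
    Submodule.add_mem_sup hv (Submodule.mem_map_of_mem hw)
  have hx {v : R} (hv : v ∈ skewSpan x a b) := x_mul_mem_skewSpan hv
  have hb {v : R} (hv : v ∈ skewSpan x a b) := h.b_mul_mem_skewSpan hv
  have hn (n : ℕ) {v : R} (hv : v ∈ skewSpan x a b) := h.a_pow_mul_mem_skewSpan n hv
  have move {g r : R} (hg : g * y + y * g = r) (hge : g * e ∈ skewSpan x a b)
      (hgd : g * d ∈ skewSpan x a b) (hr : r * e ∈ skewSpan x a b) :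
      g * (d + y * e) ∈ skewSpan x a b ⊔ (skewSpan x a b).map (LinearMap.mulLeft ℂ y) := by
    have : g * (d + y * e) = (g * d + r * e) + y * (-(g * e)) := by rw [← hg]; noncomm_ring
    rw [this]
    exact key (add_mem hgd hr) (neg_mem hge)
  rw [LinearMap.mulLeft_apply]
  rcases hz with rfl | rfl | rfl | rfl
  · refine move hxy (hx he) (hx hd) ?_
    rw [smul_mul_assoc, mul_assoc]
    exact Submodule.smul_mem _ _ (hb (hn _ he))
  · have : z * (d + z * e) = (ν • (e - a ^ p * e) - θ' • (x * (x * e))) + z * d := by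
      rw [mul_add, ← mul_assoc, eq_sub_of_add_eq hyy, sub_mul, smul_mul_assoc, smul_mul_assoc,
        sub_mul, one_mul, mul_assoc, add_comm]
    rw [this]
    exact key (sub_mem (Submodule.smul_mem _ _ (sub_mem he (hn _ he)))
      (Submodule.smul_mem _ _ (hx (hx he)))) hd
  · refine move hay (h.a_mul_mem_skewSpan he) (h.a_mul_mem_skewSpan hd) ?_
    rw [smul_mul_assoc, mul_assoc, mul_assoc]
    exact Submodule.smul_mem _ _ (hx (hb (hn _ he)))
  · refine move hby (hb he) (hb hd) ?_
    rw [mul_assoc]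
    exact hx (hn _ he)

lemma pow_mul_monomial_mem_span (h : SkewRel p ξ q x a b) (hp : 1 ≤ p) (r : Fin 2) {c : R}
    (hc : c ∈ skewSpan x a b) : y ^ (r : ℕ) * c ∈ Submodule.span ℂ (Set.range
      (fun m : Fin 2 × Fin 4 × Fin (2 * p) × Fin 2 =>
        y ^ (m.1 : ℕ) * x ^ (m.2.1 : ℕ) * a ^ (m.2.2.1 : ℕ) * b ^ (m.2.2.2 : ℕ))) := by
  set S := Submodule.span ℂ (Set.range
      (fun m : Fin 2 × Fin 4 × Fin (2 * p) × Fin 2 =>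
        y ^ (m.1 : ℕ) * x ^ (m.2.1 : ℕ) * a ^ (m.2.2.1 : ℕ) * b ^ (m.2.2.2 : ℕ)))
  have : skewSpan x a b ≤ S.comap (LinearMap.mulLeft ℂ (y ^ (r : ℕ))) := by
    refine Submodule.span_le.mpr ?_
    rintro _ ⟨⟨s, t, u⟩, rfl⟩
    simp only [Submodule.comap_coe, Set.mem_preimage, LinearMap.mulLeft_apply, SetLike.mem_coe]
    rcases lt_or_ge s 4 with hs | hs
    · rcases lt_or_ge u 2 with hu | hu
      · rw [pow_eq_pow_mod t h.a_pow]
        exact Submodule.subset_span ⟨(r, ⟨s, hs⟩, ⟨t % (2 * p), Nat.mod_lt _ (by omega)⟩, ⟨u, hu⟩),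
          by simp only [mul_assoc]⟩
      · rw [pow_eq_zero_of_le hu (by rw [sq, h.b_mul_b]), mul_zero, mul_zero]
        exact zero_mem _
    · rw [pow_eq_zero_of_le hs h.x_pow, zero_mul, zero_mul, mul_zero]
      exact zero_mem _
  exact this hc

end SkewRel

end Spanning

section Model

/-- The operator `x` of a faithful model of the algebra generated by `x`, `a`, `b`. -/
def modelX : Module.End ℂ (ℕ → ℂ → ℕ → ℂ) where
  toFun f s z u := if 1 ≤ s ∧ s < 4 then f (s - 1) z u else 0
  map_add' f g := by ext s z u; by_cases h : 1 ≤ s ∧ s < 4 <;> simp [h]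
  map_smul' c f := by ext s z u; simp

/-- The operator `a` of a faithful model of the algebra generated by `x`, `a`, `b`. -/
def modelA (ξ q : ℂ) : Module.End ℂ (ℕ → ℂ → ℕ → ℂ) where
  toFun f s z u := q ^ s * f s (ξ⁻¹ * z) u
  map_add' f g := by ext s z u; simp [mul_add]
  map_smul' c f := by ext s z u; simp [mul_left_comm]

/-- The operator `b` of a faithful model of the algebra generated by `x`, `a`, `b`. -/
def modelB (q : ℂ) : Module.End ℂ (ℕ → ℂ → ℕ → ℂ) where
  toFun f s z u := if u = 1 then q ^ s * z * f s z 0 else 0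
  map_add' f g := by ext s z u; by_cases h : u = 1 <;> simp [h, mul_add]
  map_smul' c f := by ext s z u; simp [mul_left_comm]

lemma modelX_apply (f : ℕ → ℂ → ℕ → ℂ) (s : ℕ) (z : ℂ) (u : ℕ) :
    modelX f s z u = if 1 ≤ s ∧ s < 4 then f (s - 1) z u else 0 := rfl

lemma modelA_apply (ξ q : ℂ) (f : ℕ → ℂ → ℕ → ℂ) (s : ℕ) (z : ℂ) (u : ℕ) :
    modelA ξ q f s z u = q ^ s * f s (ξ⁻¹ * z) u := rfl

lemma modelB_apply (q : ℂ) (f : ℕ → ℂ → ℕ → ℂ) (s : ℕ) (z : ℂ) (u : ℕ) :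
    modelB q f s z u = if u = 1 then q ^ s * z * f s z 0 else 0 := rfl

lemma modelA_pow_apply (ξ q : ℂ) (n : ℕ) (f : ℕ → ℂ → ℕ → ℂ) (s : ℕ) (z : ℂ) (u : ℕ) :
    (modelA ξ q ^ n) f s z u = (q ^ n) ^ s * f s ((ξ ^ n)⁻¹ * z) u := by
  induction n generalizing z with
  | zero => simp
  | succ n ih =>
    rw [pow_succ', Module.End.mul_apply, modelA_apply, ih, ← mul_assoc, ← mul_assoc, ← mul_pow,
      ← pow_succ', ← mul_inv, ← pow_succ]

lemma modelX_pow_apply (n : ℕ) (f : ℕ → ℂ → ℕ → ℂ) (s : ℕ) (z : ℂ) (u : ℕ) (hn : 1 ≤ n) :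
    (modelX ^ n) f s z u = if n ≤ s ∧ s < 4 then f (s - n) z u else 0 := by
  induction n, hn using Nat.le_induction generalizing s with
  | base => simp [modelX_apply]
  | succ n hn ih =>
    rw [pow_succ', Module.End.mul_apply, modelX_apply, ih, ← ite_and, Nat.sub_sub, add_comm 1 n]
    congr 1
    rw [eq_iff_iff]
    omega

lemma model_skewRel {p : ℕ} {ξ q : ℂ} (hξ0 : ξ ≠ 0) (hξ : ξ ^ (2 * p) = 1) (hq : q ^ (2 * p) = 1) :
    SkewRel p ξ q modelX (modelA ξ q) (modelB q) where
  a_pow := by ext f s z u; simp [modelA_pow_apply, hξ, hq]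
  b_mul_b := by ext f s z u; simp [modelB_apply]
  b_mul_a := by
    ext f s z u
    by_cases h : u = 1 <;> simp [modelA_apply, modelB_apply, h]
    field_simp
  a_mul_x := by
    ext f s z u
    rcases s with _ | s
    · simp [modelA_apply, modelX_apply]
    · by_cases h : s + 1 < 4 <;> simp [modelA_apply, modelX_apply, h]
      ring
  b_mul_x := by
    ext f s z u
    rcases s with _ | s
    · simp [modelB_apply, modelX_apply]
    · by_cases h : s + 1 < 4 <;> by_cases h' : u = 1 <;> simp [modelB_apply, modelX_apply, h, h']
      ring
  x_pow := by
    ext f s z u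
    rw [modelX_pow_apply _ _ _ _ _ (by norm_num), if_neg (by omega)]
    rfl

/-- The indicator function of a point. -/
def modelSingle (s : ℕ) (z : ℂ) (u : ℕ) : ℕ → ℂ → ℕ → ℂ :=
  fun s' z' u' => if s' = s ∧ z' = z ∧ u' = u then 1 else 0

lemma modelX_pow_single {s : ℕ} (hs : s < 4) (z : ℂ) (u : ℕ) :
    (modelX ^ s) (modelSingle 0 z u) = modelSingle s z u := by
  rcases Nat.eq_zero_or_pos s with rfl | h
  · simp
  ext s' z' u'
  rw [modelX_pow_apply _ _ _ _ _ h, modelSingle, modelSingle, ← ite_and]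
  congr 1
  rw [eq_iff_iff]
  constructor
  · rintro ⟨⟨h1, h2⟩, h3, h4⟩
    exact ⟨by omega, h4⟩
  · rintro ⟨rfl, h4⟩
    exact ⟨⟨le_rfl, hs⟩, by omega, h4⟩

lemma modelA_pow_single {ξ : ℂ} (hξ0 : ξ ≠ 0) (q : ℂ) (t u : ℕ) :
    (modelA ξ q ^ t) (modelSingle 0 1 u) = modelSingle 0 (ξ ^ t) u := by
  ext s z u'
  have e : (ξ ^ t)⁻¹ * z = 1 ↔ z = ξ ^ t := by
    rw [inv_mul_eq_one₀ (pow_ne_zero t hξ0), eq_comm]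
  by_cases h : s = 0 <;> simp [modelA_pow_apply, modelSingle, e, h]

lemma modelB_pow_single (q : ℂ) {u : ℕ} (hu : u < 2) :
    (modelB q ^ u) (modelSingle 0 1 0) = modelSingle 0 1 u := by
  interval_cases u
  · simp
  · ext s z u
    rw [pow_one, modelB_apply, modelSingle, modelSingle]
    by_cases hs : s = 0 <;> by_cases hz : z = 1 <;> by_cases hu : u = 1 <;> simp [hs, hz, hu]

lemma model_monomial_single {ξ : ℂ} (hξ0 : ξ ≠ 0) (q : ℂ) {s u : ℕ} (hs : s < 4) (t : ℕ)
    (hu : u < 2) :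
    (modelX ^ s * modelA ξ q ^ t * modelB q ^ u) (modelSingle 0 1 0) =
      modelSingle s (ξ ^ t) u := by
  rw [Module.End.mul_apply, Module.End.mul_apply, modelB_pow_single q hu, modelA_pow_single hξ0,
    modelX_pow_single hs]

end Model

section Matrices

variable {R : Type*} [Ring R]

lemma Matrix.pow_fin_two_lower {M : Matrix (Fin 2) (Fin 2) R} (h : M 1 0 = 0) (n : ℕ) :
    (M ^ n) 0 0 = M 0 0 ^ n ∧ (M ^ n) 1 0 = 0 := by
  induction n with
  | zero => simp
  | succ n ih => simp [pow_succ, Matrix.mul_apply, Fin.sum_univ_two, ih, h]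

lemma ext_monomial_apply [Algebra ℂ R] (p : ℕ) (ξ θ μ : ℂ) (x a b : R) (s t u : ℕ) (r r' : Fin 2) :
    (extY p θ μ x a ^ (r : ℕ) * extX p μ x a b ^ s * extA p ξ x a b ^ t * extB p x a b ^ u) r' 0 =
      if r' = r then x ^ s * a ^ t * b ^ u else 0 := by
  obtain ⟨hX, hX'⟩ := Matrix.pow_fin_two_lower (M := extX p μ x a b) (by simp [extX]) s
  obtain ⟨hA, hA'⟩ := Matrix.pow_fin_two_lower (M := extA p ξ x a b) (by simp [extA]) t
  obtain ⟨hB, hB'⟩ := Matrix.pow_fin_two_lower (M := extB p x a b) (by simp [extB]) u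
  have h0 : (extX p μ x a b ^ s * extA p ξ x a b ^ t * extB p x a b ^ u) 0 0 =
      x ^ s * a ^ t * b ^ u := by
    simp [Matrix.mul_apply, Fin.sum_univ_two, hX, hA, hA', hB, hB']
    simp [extX, extA, extB]
  have h1 : (extX p μ x a b ^ s * extA p ξ x a b ^ t * extB p x a b ^ u) 1 0 = 0 := by
    simp [Matrix.mul_apply, Fin.sum_univ_two, hX', hA', hB']
  rw [mul_assoc, mul_assoc, ← mul_assoc (extX p μ x a b ^ s), Matrix.mul_apply, Fin.sum_univ_two,
    h0, h1]
  fin_cases r <;> fin_cases r' <;> simp [extY]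

end Matrices

section Main

variable {p i j : ℕ} {ξ θ μ : ℂ}

lemma A3_induction {S : Submodule ℂ (A3 p i j ξ θ μ)} (h1 : 1 ∈ S)
    (hS : ∀ z ∈ ({xA3 p i j ξ θ μ, yA3 p i j ξ θ μ, aA3 p i j ξ θ μ, bA3 p i j ξ θ μ} :
      Set (A3 p i j ξ θ μ)), ∀ c ∈ S, z * c ∈ S) : S = ⊤ := by
  have key (w : FreeAlgebra ℂ (Fin 4)) :
      ∀ c ∈ S, RingQuot.mkAlgHom ℂ (A3Rel p i j ξ θ μ) w * c ∈ S := by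
    induction w using FreeAlgebra.induction with
    | grade0 r =>
      intro c hc
      rw [AlgHom.commutes, ← Algebra.smul_def]
      exact S.smul_mem r hc
    | grade1 k =>
      refine hS _ ?_
      fin_cases k <;> simp [xA3, yA3, aA3, bA3, Xg, Yg, Ag, Bg]
    | mul u v hu hv =>
      intro c hc
      rw [map_mul, mul_assoc]
      exact hu _ (hv c hc)
    | add u v hu hv =>
      intro c hc
      rw [map_add, add_mul]
      exact add_mem (hu c hc) (hv c hc)
  rw [eq_top_iff]
  rintro w -
  obtain ⟨w, rfl⟩ := RingQuot.mkAlgHom_surjective ℂ (A3Rel p i j ξ θ μ) w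
  simpa using key w 1 h1

lemma A3_skewRel :
    SkewRel p ξ (ξ ^ i) (xA3 p i j ξ θ μ) (aA3 p i j ξ θ μ) (bA3 p i j ξ θ μ) where
  a_pow := by
    simpa [aA3] using RingQuot.mkAlgHom_rel ℂ (A3Rel.r1 : A3Rel p i j ξ θ μ _ _)
  b_mul_b := by
    simpa [bA3] using RingQuot.mkAlgHom_rel ℂ (A3Rel.r2 : A3Rel p i j ξ θ μ _ _)
  b_mul_a := by
    simpa [aA3, bA3] using RingQuot.mkAlgHom_rel ℂ (A3Rel.r3 : A3Rel p i j ξ θ μ _ _)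
  a_mul_x := by
    simpa [aA3, xA3] using RingQuot.mkAlgHom_rel ℂ (A3Rel.r4 : A3Rel p i j ξ θ μ _ _)
  b_mul_x := by
    simpa [bA3, xA3] using RingQuot.mkAlgHom_rel ℂ (A3Rel.r5 : A3Rel p i j ξ θ μ _ _)
  x_pow := by
    simpa [xA3] using RingQuot.mkAlgHom_rel ℂ (A3Rel.r8 : A3Rel p i j ξ θ μ _ _)

lemma A3_span (hp : 1 ≤ p) :
    Submodule.span ℂ (Set.range (fun m : Fin 2 × Fin 4 × Fin (2 * p) × Fin 2 =>
      yA3 p i j ξ θ μ ^ (m.1 : ℕ) * xA3 p i j ξ θ μ ^ (m.2.1 : ℕ) *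
        aA3 p i j ξ θ μ ^ (m.2.2.1 : ℕ) * bA3 p i j ξ θ μ ^ (m.2.2.2 : ℕ))) = ⊤ := by
  have h := A3_skewRel (p := p) (i := i) (j := j) (ξ := ξ) (θ := θ) (μ := μ)
  have r6 := RingQuot.mkAlgHom_rel ℂ (A3Rel.r6 : A3Rel p i j ξ θ μ _ _)
  have r7 := RingQuot.mkAlgHom_rel ℂ (A3Rel.r7 : A3Rel p i j ξ θ μ _ _)
  have r9 := RingQuot.mkAlgHom_rel ℂ (A3Rel.r9 : A3Rel p i j ξ θ μ _ _)
  have r10 := RingQuot.mkAlgHom_rel ℂ (A3Rel.r10 : A3Rel p i j ξ θ μ _ _)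
  simp only [map_add, map_mul, map_smul, map_pow, map_sub, map_one] at r6 r7 r9 r10
  have top := A3_induction
    (S := skewSpan (xA3 p i j ξ θ μ) (aA3 p i j ξ θ μ) (bA3 p i j ξ θ μ) ⊔
      (skewSpan (xA3 p i j ξ θ μ) (aA3 p i j ξ θ μ) (bA3 p i j ξ θ μ)).map
        (LinearMap.mulLeft ℂ (yA3 p i j ξ θ μ)))
    (Submodule.mem_sup_left (by simpa using monomial_mem_skewSpan _ _ _ 0 0 0))
    (fun z hz c hc => h.mem_skewSpan_sup r6 r7 r9 r10 hz hc)
  rw [eq_top_iff, ← top]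
  refine sup_le (fun c hc => by simpa using h.pow_mul_monomial_mem_span hp 0 hc) ?_
  rintro _ ⟨c, hc, rfl⟩
  simpa using h.pow_mul_monomial_mem_span hp 1 hc

lemma A3_linearIndependent (hp : 1 ≤ p) (hpe : Even p) (hi : i = p - 1)
    (hξ : IsPrimitiveRoot ξ (2 * p))
    (hθ : θ ^ 2 = (1 - (ξ ^ 2)⁻¹) * ((ξ - 1) / (ξ + 1))) :
    LinearIndependent ℂ (fun m : Fin 2 × Fin 4 × Fin (2 * p) × Fin 2 =>
      yA3 p i j ξ θ μ ^ (m.1 : ℕ) * xA3 p i j ξ θ μ ^ (m.2.1 : ℕ) *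
        aA3 p i j ξ θ μ ^ (m.2.2.1 : ℕ) * bA3 p i j ξ θ μ ^ (m.2.2.2 : ℕ)) := by
  have hp2 : 2 ≤ p := by obtain ⟨k, rfl⟩ := hpe; omega
  have hξ0 : ξ ≠ 0 := hξ.ne_zero (by omega)
  have hξp : ξ ^ p = -1 := by
    have : IsPrimitiveRoot (ξ ^ p) 2 := hξ.pow (by omega) (mul_comm 2 p)
    exact this.eq_neg_one_of_two_right
  have hq : ξ ^ i * ξ = -1 := by rw [← pow_succ, hi, Nat.sub_add_cancel hp, hξp]
  have hξ1 : ξ ≠ 1 := hξ.ne_one (by omega)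
  have hξ2 : ξ ≠ -1 := by
    rintro rfl
    have := hξ.dvd_of_pow_eq_one 2 (by norm_num)
    have := Nat.le_of_dvd (by norm_num) this
    omega
  have h := model_skewRel (p := p) (q := ξ ^ i) hξ0 hξ.pow_eq_one
    (by rw [← pow_mul, mul_comm, pow_mul, hξ.pow_eq_one, one_pow])
  have hrel := h.ext_rel (θ := θ) (μ := μ) (j := j) hp hpe hq hξ1 hξ2 hξp hθ rfl
  let φ := RingQuot.liftAlgHom ℂ ⟨FreeAlgebra.lift ℂ
    ![extX p μ modelX (modelA ξ (ξ ^ i)) (modelB (ξ ^ i)), extY p θ μ modelX (modelA ξ (ξ ^ i)),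
      extA p ξ modelX (modelA ξ (ξ ^ i)) (modelB (ξ ^ i)),
      extB p modelX (modelA ξ (ξ ^ i)) (modelB (ξ ^ i))], hrel⟩
  let ev (m : Fin 2 × Fin 4 × Fin (2 * p) × Fin 2) : A3 p i j ξ θ μ →ₗ[ℂ] ℂ :=
    LinearMap.proj (m.2.2.2 : ℕ) ∘ₗ LinearMap.proj (ξ ^ (m.2.2.1 : ℕ)) ∘ₗ
      LinearMap.proj (φ := fun _ => ℂ → ℕ → ℂ) (m.2.1 : ℕ) ∘ₗ
      LinearMap.applyₗ (modelSingle 0 1 0) ∘ₗ Matrix.entryLinearMap ℂ _ m.1 0 ∘ₗ φ.toLinearMap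
  have hev (m n : Fin 2 × Fin 4 × Fin (2 * p) × Fin 2) :
      ev m (yA3 p i j ξ θ μ ^ (n.1 : ℕ) * xA3 p i j ξ θ μ ^ (n.2.1 : ℕ) *
        aA3 p i j ξ θ μ ^ (n.2.2.1 : ℕ) * bA3 p i j ξ θ μ ^ (n.2.2.2 : ℕ)) =
      if m = n then 1 else 0 := by
    obtain ⟨r, s, t, u⟩ := m
    obtain ⟨r', s', t', u'⟩ := n
    have ht : ξ ^ (t : ℕ) = ξ ^ (t' : ℕ) ↔ t = t' :=
      ⟨fun e => Fin.ext (hξ.pow_inj t.2 t'.2 e), fun e => by rw [e]⟩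
    simp only [ev, LinearMap.comp_apply, LinearMap.proj_apply, AlgHom.toLinearMap_apply, map_mul,
      map_pow, φ, yA3, xA3, aA3, bA3, RingQuot.liftAlgHom_mkAlgHom_apply, Xg, Yg, Ag, Bg,
      FreeAlgebra.lift_ι_apply, Matrix.cons_val, Matrix.entryLinearMap_apply,
      LinearMap.applyₗ_apply_apply, ext_monomial_apply]
    by_cases hr : r = r'
    · rw [if_pos hr, model_monomial_single hξ0 _ s'.2 _ u'.2, modelSingle]
      simp [hr, ht, Fin.ext_iff]
    · simp [hr]
  exact LinearIndependent.of_pairwise_dual_eq_zero_one _ ev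
    (fun m n hmn => (hev m n).trans (if_neg hmn)) (fun m => (hev m m).trans (if_pos rfl))

end Main

/-- for `(i,j) ∈ Λ³_p` and `μ ∈ ℂ`, the `32p` monomials `y^r·x^s·a^t·b^u`
(`r,u ∈ {0,1}`, `s ∈ {0,…,3}`, `t ∈ {0,…,2p-1}`) form a `ℂ`-basis of `𝔄_{i,j}(μ)`;
in particular `dim_ℂ 𝔄_{i,j}(μ) = 32p`. -/
theorem statement12 (p : ℕ) (hp : 1 ≤ p) (hpe : 2 ∣ p) (hp2 : Odd (p / 2))
    (i j : ℕ) (hi : i = p - 1) (hj : j = p / 2 ∨ j = 3 * p / 2)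
    (ξ θ μ : ℂ) (hξ : IsPrimitiveRoot ξ (2 * p))
    (hθ : θ ^ 2 = (1 - (ξ ^ 2)⁻¹) * ((ξ - 1) / (ξ + 1))) :
    LinearIndependent ℂ (fun m : Fin 2 × Fin 4 × Fin (2 * p) × Fin 2 =>
      yA3 p i j ξ θ μ ^ (m.1 : ℕ) * xA3 p i j ξ θ μ ^ (m.2.1 : ℕ) *
        aA3 p i j ξ θ μ ^ (m.2.2.1 : ℕ) * bA3 p i j ξ θ μ ^ (m.2.2.2 : ℕ)) ∧
    Submodule.span ℂ (Set.range (fun m : Fin 2 × Fin 4 × Fin (2 * p) × Fin 2 =>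
      yA3 p i j ξ θ μ ^ (m.1 : ℕ) * xA3 p i j ξ θ μ ^ (m.2.1 : ℕ) *
        aA3 p i j ξ θ μ ^ (m.2.2.1 : ℕ) * bA3 p i j ξ θ μ ^ (m.2.2.2 : ℕ))) = ⊤ ∧
    Module.finrank ℂ (A3 p i j ξ θ μ) = 32 * p := by
  have hli := A3_linearIndependent (j := j) (μ := μ) hp (even_iff_two_dvd.mpr hpe) hi hξ hθ
  have hspan := A3_span (i := i) (j := j) (ξ := ξ) (θ := θ) (μ := μ) hp
  refine ⟨hli, hspan, ?_⟩
  rw [Module.finrank_eq_card_basis (Module.Basis.mk hli hspan.ge)]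
  simp only [Fintype.card_prod, Fintype.card_fin]
  ring
end
end

section
/- (1) Suppose ξ^{-ij} = -1 and let N be the multiplicative order of (-1)^i·ξ^{-j}. Then the quotient of the free ℂ-algebra on v₁, v₂ by the two-sided ideal generated by v₁², v₁v₂ + ξ^{-j}·v₂v₁, and v₂^N has ℂ-basis the images of {v₂^{n₂}·v₁^{n₁} : n₁ ∈ {0,1}, 0 ≤ n₂ ≤ N-1}; in particular its dimension is 2N. (2) Suppose ξ^{(i+1)(p-j)} = -1 and let N be the multiplicative order of ξ^{-ij}. Then the quotient of the free ℂ-algebra on v₁, v₂ by the two-sided ideal generated by v₁v₂ + (-1)^{i+1}·v₂v₁, v₂² + (-1)^{i+1}·θ^{-2}·ξ^{-2(i+1)}·v₁², and v₁^N has ℂ-basis the images of {v₂^{n₂}·v₁^{n₁} : 0 ≤ n₁ ≤ N-1, n₂ ∈ {0,1}}; in particular its dimension is 2N. -/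
noncomputable section

/-- Generator `v₁` of the free algebra on two generators. -/
def W1 : FreeAlgebra ℂ (Fin 2) := FreeAlgebra.ι ℂ (0 : Fin 2)

/-- Generator `v₂` of the free algebra on two generators. -/
def W2 : FreeAlgebra ℂ (Fin 2) := FreeAlgebra.ι ℂ (1 : Fin 2)

/-- The defining relations of `B(V_{i,j})` in the case `ξ^{-ij} = -1`:
`v₁² = 0`, `v₁v₂ + ξ^{-j}·v₂v₁ = 0`, `v₂^N = 0`. -/
inductive QRel1 (j N : ℕ) (ξ : ℂ) :
    FreeAlgebra ℂ (Fin 2) → FreeAlgebra ℂ (Fin 2) → Prop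
  | r1 : QRel1 j N ξ (W1 * W1) 0
  | r2 : QRel1 j N ξ (W1 * W2 + (ξ ^ j)⁻¹ • (W2 * W1)) 0
  | r3 : QRel1 j N ξ (W2 ^ N) 0

/-- The defining relations of `B(V_{i,j})` in the case `ξ^{(i+1)(p-j)} = -1`:
`v₁v₂ + (-1)^{i+1}·v₂v₁ = 0`, `v₂² + (-1)^{i+1}·θ⁻²·ξ^{-2(i+1)}·v₁² = 0`, `v₁^N = 0`. -/
inductive QRel2 (i N : ℕ) (ξ θ : ℂ) :
    FreeAlgebra ℂ (Fin 2) → FreeAlgebra ℂ (Fin 2) → Prop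
  | r1 : QRel2 i N ξ θ (W1 * W2 + ((-1 : ℂ) ^ (i + 1)) • (W2 * W1)) 0
  | r2 : QRel2 i N ξ θ
      (W2 * W2 + ((-1 : ℂ) ^ (i + 1) * (θ ^ 2)⁻¹ * (ξ ^ (2 * (i + 1)))⁻¹) • (W1 * W1)) 0
  | r3 : QRel2 i N ξ θ (W1 ^ N) 0

open Polynomial in
/-- The truncated polynomial ring `ℂ[X]/(X^N)`. -/
abbrev TruncPoly (N : ℕ) : Type := AdjoinRoot (X ^ N : ℂ[X])

/-- The class of `X` in `ℂ[X]/(X^N)`. -/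
def truncX (N : ℕ) : TruncPoly N := AdjoinRoot.root _

lemma truncX_pow (N : ℕ) : truncX N ^ N = 0 := by
  rw [truncX, ← AdjoinRoot.mk_X, ← map_pow, AdjoinRoot.mk_self]

lemma eq_zero_of_sum_smul_truncX_pow {N : ℕ} (g : Fin N → ℂ)
    (h : ∑ a, g a • truncX N ^ (a : ℕ) = 0) (a : Fin N) : g a = 0 := by
  have key : AdjoinRoot.mk (Polynomial.X ^ N : Polynomial ℂ)
      (∑ a, g a • (Polynomial.X : Polynomial ℂ) ^ (a : ℕ)) = 0 := by
    rw [← h, map_sum]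
    refine Finset.sum_congr rfl fun b _ => ?_
    rw [← AdjoinRoot.smul_mk, map_pow, AdjoinRoot.mk_X, truncX]
  rw [AdjoinRoot.mk_eq_zero, Polynomial.X_pow_dvd_iff] at key
  have := key a a.2
  simpa [Polynomial.finsetSum_coeff, Polynomial.coeff_X_pow, Fin.val_inj] using this

/-- The operator `diag(x, t x)` on `(ℂ[x]/(x^N))²`. -/
def diagMat (N : ℕ) (t : ℂ) : Matrix (Fin 2) (Fin 2) (TruncPoly N) :=
  !![truncX N, 0; 0, t • truncX N]

/-- The operator on `(ℂ[x]/(x^N))²` exchanging the summands, with square `κ x²`. -/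
def swapMat (N : ℕ) (κ : ℂ) : Matrix (Fin 2) (Fin 2) (TruncPoly N) :=
  !![0, κ • truncX N ^ 2; 1, 0]

lemma diagMat_pow (N : ℕ) (t : ℂ) (a : ℕ) :
    diagMat N t ^ a = !![truncX N ^ a, 0; 0, t ^ a • truncX N ^ a] := by
  induction a with
  | zero => simp [Matrix.one_fin_two]
  | succ a ih =>
    rw [pow_succ, ih]
    simp [diagMat, smul_smul, pow_succ, mul_comm]

lemma diagMat_pow_self (N : ℕ) (t : ℂ) : diagMat N t ^ N = 0 := by
  rw [diagMat_pow, truncX_pow, smul_zero]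
  ext i j
  fin_cases i <;> fin_cases j <;> rfl

lemma diagMat_mul_swapMat (N : ℕ) {t κ : ℂ} (h : κ * t ^ 2 = κ) :
    diagMat N t * swapMat N κ = t • (swapMat N κ * diagMat N t) := by
  have h' : t * (κ * t) = κ := by linear_combination h
  simp [diagMat, swapMat, Matrix.smul_of, smul_smul, h', pow_succ, mul_assoc]

lemma swapMat_mul_self (N : ℕ) {t κ : ℂ} (h : κ * t ^ 2 = κ) :
    swapMat N κ * swapMat N κ = κ • (diagMat N t * diagMat N t) := by
  have h' : κ * (t * t) = κ := by linear_combination h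
  simp [diagMat, swapMat, Matrix.smul_of, smul_smul, h', pow_succ]

lemma swapMat_pow_mul_diagMat_pow_apply (N : ℕ) (t κ : ℂ) (a : ℕ) (b c : Fin 2) :
    (swapMat N κ ^ (b : ℕ) * diagMat N t ^ a) c 0 = if b = c then truncX N ^ a else 0 := by
  rw [diagMat_pow]
  fin_cases b <;> fin_cases c <;> simp [swapMat]

section Presentation

variable {A : Type*} [Ring A] [Algebra ℂ A] {x y : A} {t κ : ℂ} {N : ℕ}

lemma linearIndependent_of_matrix_model (φ : A →ₐ[ℂ] Matrix (Fin 2) (Fin 2) (TruncPoly N))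
    (hx : φ x = diagMat N t) (hy : φ y = swapMat N κ) :
    LinearIndependent ℂ (fun m : Fin N × Fin 2 => y ^ (m.2 : ℕ) * x ^ (m.1 : ℕ)) := by
  rw [Fintype.linearIndependent_iff]
  rintro g hg ⟨a, c⟩
  refine eq_zero_of_sum_smul_truncX_pow (fun a => g (a, c)) ?_ a
  have h := congrArg (fun z => φ z c 0) hg
  simp only [map_sum, map_smul, map_mul, map_pow, hx, hy, map_zero, Matrix.sum_apply,
    Matrix.smul_apply, swapMat_pow_mul_diagMat_pow_apply, Matrix.zero_apply,
    Fintype.sum_prod_type] at h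
  simpa using h

lemma span_of_relations (hgen : Algebra.adjoin ℂ {x, y} = ⊤) (hxy : x * y = t • (y * x))
    (hyy : y * y = κ • (x * x)) (hN : x ^ N = 0) :
    Submodule.span ℂ
      (Set.range fun m : Fin N × Fin 2 => y ^ (m.2 : ℕ) * x ^ (m.1 : ℕ)) = ⊤ := by
  set S := Submodule.span ℂ
    (Set.range fun m : Fin N × Fin 2 => y ^ (m.2 : ℕ) * x ^ (m.1 : ℕ)) with hS
  have mem (b : Fin 2) (a : ℕ) : y ^ (b : ℕ) * x ^ a ∈ S := by
    by_cases h : a < N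
    · exact Submodule.subset_span ⟨(⟨a, h⟩, b), rfl⟩
    · rw [pow_eq_zero_of_le (not_lt.mp h) hN, mul_zero]
      exact S.zero_mem
  have mem_zero (a : ℕ) : x ^ a ∈ S := by simpa using mem 0 a
  have mem_one (a : ℕ) : y * x ^ a ∈ S := by simpa using mem 1 a
  have stable (z : A) (hz : ∀ (b : Fin 2) (a : ℕ), z * (y ^ (b : ℕ) * x ^ a) ∈ S) :
      ∀ s ∈ S, z * s ∈ S := by
    intro s hs
    induction hs using Submodule.span_induction with
    | mem s hs =>
      obtain ⟨m, rfl⟩ := hs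
      exact hz _ _
    | zero => simp
    | add u v _ _ hu hv => rw [mul_add]; exact S.add_mem hu hv
    | smul c u _ hu => rw [mul_smul_comm]; exact S.smul_mem c hu
  have hmul (z : A) : ∀ s ∈ S, z * s ∈ S := by
    have hz : z ∈ Algebra.adjoin ℂ {x, y} := hgen ▸ Algebra.mem_top
    induction hz using Algebra.adjoin_induction with
    | mem z hz =>
      rcases hz with rfl | rfl
      · refine stable _ fun b a => ?_
        fin_cases b
        · simpa [← pow_succ'] using mem_zero (a + 1)
        · have : z * (y * z ^ a) = t • (y * z ^ (a + 1)) := by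
            rw [← mul_assoc, hxy, smul_mul_assoc, mul_assoc, pow_succ']
          simpa [this] using S.smul_mem t (mem_one (a + 1))
      · refine stable _ fun b a => ?_
        fin_cases b
        · simpa using mem_one a
        · have : z * (z * x ^ a) = κ • x ^ (a + 2) := by
            rw [← mul_assoc, hyy, smul_mul_assoc, ← pow_two, ← pow_add, add_comm]
          simpa [this] using S.smul_mem κ (mem_zero (a + 2))
    | algebraMap c =>
      intro s hs
      rw [← Algebra.smul_def]
      exact S.smul_mem c hs
    | add u v _ _ hu hv =>
      intro s hs
      rw [add_mul]
      exact S.add_mem (hu s hs) (hv s hs)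
    | mul u v _ _ hu hv =>
      intro s hs
      rw [mul_assoc]
      exact hu _ (hv s hs)
  refine eq_top_iff.mpr fun z _ => ?_
  simpa using hmul z 1 (by simpa using mem_zero 0)

lemma pow_mul_of_skew_commute (hxy : x * y = t • (y * x)) (a : ℕ) :
    x ^ a * y = t ^ a • (y * x ^ a) := by
  induction a with
  | zero => simp
  | succ a ih =>
    rw [pow_succ', mul_assoc, ih, mul_smul_comm, ← mul_assoc, hxy, smul_mul_assoc, smul_smul,
      mul_assoc, pow_succ]

/-- The basis `yᵇ xᵃ` of an algebra presented by `xy = t yx`, `y² = κ x²`, `x^N = 0`. -/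
def presentationBasis (hgen : Algebra.adjoin ℂ {x, y} = ⊤) (hxy : x * y = t • (y * x))
    (hyy : y * y = κ • (x * x)) (hN : x ^ N = 0)
    (φ : A →ₐ[ℂ] Matrix (Fin 2) (Fin 2) (TruncPoly N))
    (hx : φ x = diagMat N t) (hy : φ y = swapMat N κ) : Module.Basis (Fin N × Fin 2) ℂ A :=
  Module.Basis.mk (linearIndependent_of_matrix_model φ hx hy)
    (span_of_relations hgen hxy hyy hN).ge

/-- The basis `xᵃ yᵇ` of an algebra presented by `xy = t yx`, `y² = κ x²`, `x^N = 0`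
with `t ≠ 0`. -/
def presentationBasisSwap (ht : t ≠ 0) (hgen : Algebra.adjoin ℂ {x, y} = ⊤)
    (hxy : x * y = t • (y * x)) (hyy : y * y = κ • (x * x)) (hN : x ^ N = 0)
    (φ : A →ₐ[ℂ] Matrix (Fin 2) (Fin 2) (TruncPoly N))
    (hx : φ x = diagMat N t) (hy : φ y = swapMat N κ) : Module.Basis (Fin 2 × Fin N) ℂ A :=
  ((presentationBasis hgen hxy hyy hN φ hx hy).unitsSMul
    fun m => Units.mk0 t ht ^ ((m.1 : ℕ) * (m.2 : ℕ))).reindex (Equiv.prodComm _ _)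

lemma coe_presentationBasis (hgen : Algebra.adjoin ℂ {x, y} = ⊤) (hxy : x * y = t • (y * x))
    (hyy : y * y = κ • (x * x)) (hN : x ^ N = 0)
    (φ : A →ₐ[ℂ] Matrix (Fin 2) (Fin 2) (TruncPoly N))
    (hx : φ x = diagMat N t) (hy : φ y = swapMat N κ) :
    ⇑(presentationBasis hgen hxy hyy hN φ hx hy) =
      fun m => y ^ (m.2 : ℕ) * x ^ (m.1 : ℕ) :=
  Module.Basis.coe_mk _ _

lemma coe_presentationBasisSwap (ht : t ≠ 0) (hgen : Algebra.adjoin ℂ {x, y} = ⊤)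
    (hxy : x * y = t • (y * x)) (hyy : y * y = κ • (x * x)) (hN : x ^ N = 0)
    (φ : A →ₐ[ℂ] Matrix (Fin 2) (Fin 2) (TruncPoly N))
    (hx : φ x = diagMat N t) (hy : φ y = swapMat N κ) :
    ⇑(presentationBasisSwap ht hgen hxy hyy hN φ hx hy) =
      fun m => x ^ (m.2 : ℕ) * y ^ (m.1 : ℕ) := by
  funext ⟨b, a⟩
  simp only [presentationBasisSwap, Module.Basis.reindex_apply, Module.Basis.unitsSMul_apply,
    coe_presentationBasis, Equiv.prodComm_symm, Equiv.prodComm_apply, Prod.swap_prod_mk]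
  fin_cases b
  · simp
  · simp [pow_mul_of_skew_commute hxy, Units.smul_def]

end Presentation

lemma Module.Basis.linearIndependent_span_finrank {ι A : Type*} [Fintype ι] [Ring A]
    [Algebra ℂ A] (B : Module.Basis ι ℂ A) {f : ι → A} (hB : ⇑B = f) {n : ℕ}
    (hn : Fintype.card ι = n) :
    LinearIndependent ℂ f ∧ Submodule.span ℂ (Set.range f) = ⊤ ∧ Module.finrank ℂ A = n :=
  ⟨hB ▸ B.linearIndependent, hB ▸ B.span_eq, (Module.finrank_eq_card_basis B).trans hn⟩

lemma eq_neg_smul_of_add_smul_eq_zero {A : Type*} [Ring A] [Algebra ℂ A] {u v : A} {c : ℂ}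
    (h : u + c • v = 0) : u = (-c) • v := by
  rw [eq_neg_of_add_eq_zero_left h, neg_smul]

lemma eq_neg_smul_of_add_inv_smul_eq_zero {A : Type*} [Ring A] [Algebra ℂ A] {u v : A} {c : ℂ}
    (hc : c ≠ 0) (h : u + c⁻¹ • v = 0) : v = (-c) • u := by
  rw [eq_neg_smul_of_add_smul_eq_zero h, smul_smul, neg_mul_neg, mul_inv_cancel₀ hc, one_smul]

lemma adjoin_mkAlgHom_eq_top (r : FreeAlgebra ℂ (Fin 2) → FreeAlgebra ℂ (Fin 2) → Prop) :
    Algebra.adjoin ℂ {RingQuot.mkAlgHom ℂ r W1, RingQuot.mkAlgHom ℂ r W2} = ⊤ := by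
  have h : ({W1, W2} : Set (FreeAlgebra ℂ (Fin 2))) = Set.range (FreeAlgebra.ι ℂ) := by
    ext z
    simp [W1, W2, eq_comm]
  rw [← Set.image_pair, ← AlgHom.map_adjoin, h, FreeAlgebra.adjoin_range_ι, Algebra.map_top,
    AlgHom.range_eq_top]
  exact RingQuot.mkAlgHom_surjective ℂ r

lemma QRel1.basis (j N : ℕ) {ξ : ℂ} (hξ : ξ ≠ 0) :
    ∃ B : Module.Basis (Fin 2 × Fin N) ℂ (RingQuot (QRel1 j N ξ)),
      ⇑B = fun m => RingQuot.mkAlgHom ℂ (QRel1 j N ξ) W2 ^ (m.2 : ℕ) *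
          RingQuot.mkAlgHom ℂ (QRel1 j N ξ) W1 ^ (m.1 : ℕ) := by
  have hc : ξ ^ j ≠ 0 := pow_ne_zero _ hξ
  have ht : -ξ ^ j ≠ 0 := neg_ne_zero.mpr hc
  set ψ := FreeAlgebra.lift ℂ ![swapMat N 0, diagMat N (-ξ ^ j)] with hψ
  have h1 : ψ W1 = swapMat N 0 := by simp [hψ, W1]
  have h2 : ψ W2 = diagMat N (-ξ ^ j) := by simp [hψ, W2]
  have hr : ∀ ⦃u v⦄, QRel1 j N ξ u v → ψ u = ψ v := by
    rintro u v (_ | _ | _)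
    · simpa [h1] using swapMat_mul_self N (t := 0) (κ := 0) (by simp)
    · simp [h1, h2, diagMat_mul_swapMat N (t := -ξ ^ j) (κ := 0) (by simp), smul_smul, hc]
    · simp [h2, diagMat_pow_self]
  have e1 := RingQuot.mkAlgHom_rel ℂ (QRel1.r1 (j := j) (N := N) (ξ := ξ))
  have e2 := RingQuot.mkAlgHom_rel ℂ (QRel1.r2 (j := j) (N := N) (ξ := ξ))
  have e3 := RingQuot.mkAlgHom_rel ℂ (QRel1.r3 (j := j) (N := N) (ξ := ξ))
  simp only [map_add, map_mul, map_smul, map_pow, map_zero] at e1 e2 e3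
  exact ⟨presentationBasisSwap (κ := 0) ht
    (Set.pair_comm _ _ ▸ adjoin_mkAlgHom_eq_top _)
    (eq_neg_smul_of_add_inv_smul_eq_zero hc e2) (by rw [e1, zero_smul]) e3
    (RingQuot.liftAlgHom ℂ ⟨ψ, hr⟩) (by simp [h2]) (by simp [h1]),
    coe_presentationBasisSwap ..⟩

lemma QRel2.basis (i N : ℕ) (ξ θ : ℂ) :
    ∃ B : Module.Basis (Fin N × Fin 2) ℂ (RingQuot (QRel2 i N ξ θ)),
      ⇑B = fun m => RingQuot.mkAlgHom ℂ (QRel2 i N ξ θ) W2 ^ (m.2 : ℕ) *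
          RingQuot.mkAlgHom ℂ (QRel2 i N ξ θ) W1 ^ (m.1 : ℕ) := by
  set t : ℂ := -(-1) ^ (i + 1) with ht
  set κ : ℂ := -((-1 : ℂ) ^ (i + 1) * (θ ^ 2)⁻¹ * (ξ ^ (2 * (i + 1)))⁻¹) with hκ
  have h : κ * t ^ 2 = κ := by
    rw [ht, neg_sq, ← pow_mul, mul_comm (i + 1), pow_mul]
    simp
  set ψ := FreeAlgebra.lift ℂ ![diagMat N t, swapMat N κ] with hψ
  have h1 : ψ W1 = diagMat N t := by simp [hψ, W1]
  have h2 : ψ W2 = swapMat N κ := by simp [hψ, W2]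
  have hr : ∀ ⦃u v⦄, QRel2 i N ξ θ u v → ψ u = ψ v := by
    rintro u v (_ | _ | _)
    · rw [map_add, map_smul, map_mul, map_mul, h1, h2, diagMat_mul_swapMat N h, ht, neg_smul,
        neg_add_cancel, map_zero]
    · rw [map_add, map_smul, map_mul, map_mul, h1, h2, swapMat_mul_self N h, hκ, neg_smul,
        neg_add_cancel, map_zero]
    · rw [map_pow, h1, diagMat_pow_self, map_zero]
  have e1 := RingQuot.mkAlgHom_rel ℂ (QRel2.r1 (i := i) (N := N) (ξ := ξ) (θ := θ))
  have e2 := RingQuot.mkAlgHom_rel ℂ (QRel2.r2 (i := i) (N := N) (ξ := ξ) (θ := θ))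
  have e3 := RingQuot.mkAlgHom_rel ℂ (QRel2.r3 (i := i) (N := N) (ξ := ξ) (θ := θ))
  simp only [map_add, map_mul, map_smul, map_pow, map_zero] at e1 e2 e3
  exact ⟨presentationBasis (t := t) (κ := κ) (adjoin_mkAlgHom_eq_top _)
    (eq_neg_smul_of_add_smul_eq_zero e1) (eq_neg_smul_of_add_smul_eq_zero e2) e3
    (RingQuot.liftAlgHom ℂ ⟨ψ, hr⟩) (by simp [h1]) (by simp [h2]),
    coe_presentationBasis ..⟩

/-- presentations and bases of the quadratic Nichols algebras `B(V_{i,j})`.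
(1) If `ξ^{-ij} = -1` and `N = ord((-1)^i·ξ^{-j})`, the quotient by `QRel1` has basis
`{v₂^{n₂}·v₁^{n₁} : n₁ ∈ {0,1}, 0 ≤ n₂ ≤ N-1}`, so has dimension `2N`.
(2) If `ξ^{(i+1)(p-j)} = -1` and `N = ord(ξ^{-ij})`, the quotient by `QRel2` has basis
`{v₂^{n₂}·v₁^{n₁} : 0 ≤ n₁ ≤ N-1, n₂ ∈ {0,1}}`, so has dimension `2N`. -/
theorem statement18 (p : ℕ) (hp : 1 ≤ p) (ξ θ : ℂ) (hξ : IsPrimitiveRoot ξ (2 * p))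
    (hθ : θ ^ 2 = (1 - (ξ ^ 2)⁻¹) * ((ξ - 1) / (ξ + 1)))
    (i j : ℕ) (hi : i < 2 * p) (hj : j < 2 * p)
    (hΛ : ¬ ((2 * p : ℤ) ∣ ((p : ℤ) * (i : ℤ) - (j : ℤ)))) :
    (∀ N : ℕ, (ξ ^ (i * j))⁻¹ = -1 → orderOf ((-1 : ℂ) ^ i * (ξ ^ j)⁻¹) = N →
      LinearIndependent ℂ (fun m : Fin 2 × Fin N =>
        RingQuot.mkAlgHom ℂ (QRel1 j N ξ) W2 ^ (m.2 : ℕ) *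
          RingQuot.mkAlgHom ℂ (QRel1 j N ξ) W1 ^ (m.1 : ℕ)) ∧
      Submodule.span ℂ (Set.range (fun m : Fin 2 × Fin N =>
        RingQuot.mkAlgHom ℂ (QRel1 j N ξ) W2 ^ (m.2 : ℕ) *
          RingQuot.mkAlgHom ℂ (QRel1 j N ξ) W1 ^ (m.1 : ℕ))) = ⊤ ∧
      Module.finrank ℂ (RingQuot (QRel1 j N ξ)) = 2 * N) ∧
    (∀ N : ℕ, ξ ^ (((i : ℤ) + 1) * ((p : ℤ) - (j : ℤ))) = -1 →
      orderOf ((ξ ^ (i * j))⁻¹) = N →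
      LinearIndependent ℂ (fun m : Fin N × Fin 2 =>
        RingQuot.mkAlgHom ℂ (QRel2 i N ξ θ) W2 ^ (m.2 : ℕ) *
          RingQuot.mkAlgHom ℂ (QRel2 i N ξ θ) W1 ^ (m.1 : ℕ)) ∧
      Submodule.span ℂ (Set.range (fun m : Fin N × Fin 2 =>
        RingQuot.mkAlgHom ℂ (QRel2 i N ξ θ) W2 ^ (m.2 : ℕ) *
          RingQuot.mkAlgHom ℂ (QRel2 i N ξ θ) W1 ^ (m.1 : ℕ))) = ⊤ ∧
      Module.finrank ℂ (RingQuot (QRel2 i N ξ θ)) = 2 * N) := by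
  have hξ0 : ξ ≠ 0 := hξ.ne_zero (by omega)
  refine ⟨fun N _ _ => ?_, fun N _ _ => ?_⟩
  · obtain ⟨B, hB⟩ := QRel1.basis j N hξ0
    exact B.linearIndependent_span_finrank hB (by simp)
  · obtain ⟨B, hB⟩ := QRel2.basis i N ξ θ
    exact B.linearIndependent_span_finrank hB (by simp [mul_comm])
end
end
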